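/- arXiv:2303.07162 — 4 statements merged into one kernel-verified Lean document; each statement's English description precedes it below -/
import Mathlib

section
/- (Hardy–Poincaré inequality) Let d ≥ 1, α* = (2-d)/2, and let α < 0 with α ≠ α* when d ≥ 3. Then there exists a constant Λ_{α,d} > 0 such that for every D > 0 and every f ∈ H¹((D+|x|²)^α dx) with ∫_{ℝ^d} f (D+|x|²)^{α-1} dx = 0, one has Λ_{α,d} ∫_{ℝ^d} |f|² (D+|x|²)^{α-1} dx ≤ ∫_{ℝ^d} |∇f|² (D+|x|²)^α dx. -/
open MeasureTheory Real

noncomputable section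

lemma hp_ibp {d : ℕ} (u : EuclideanSpace ℝ (Fin d) → ℝ) (hu : Differentiable ℝ u)
    (φ φ' : ℝ → ℝ) (hφ : ∀ s, 0 ≤ s → HasDerivAt φ (φ' s) s)
    (hc : Continuous (fun x : EuclideanSpace ℝ (Fin d) => φ' (‖x‖ ^ 2)))
    (h1 : Integrable (fun x => ‖fderiv ℝ u x‖ * (‖x‖ * φ (‖x‖ ^ 2))))
    (h2 : Integrable (fun x => u x * (‖x‖ * φ (‖x‖ ^ 2))))
    (h3 : Integrable (fun x => u x * φ (‖x‖ ^ 2)))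
    (h4 : Integrable (fun x => u x * (‖x‖ ^ 2 * φ' (‖x‖ ^ 2)))) :
    ∫ x, (fderiv ℝ u x x * φ (‖x‖ ^ 2)
      + u x * (d * φ (‖x‖ ^ 2) + 2 * (‖x‖ ^ 2 * φ' (‖x‖ ^ 2)))) = 0 := by
  have hφc : Continuous (fun x : EuclideanSpace ℝ (Fin d) => φ (‖x‖ ^ 2)) := by
    rw [continuous_iff_continuousAt]
    intro x
    exact ContinuousAt.comp (f := fun x : EuclideanSpace ℝ (Fin d) => ‖x‖ ^ 2)
      (hφ (‖x‖ ^ 2) (sq_nonneg _)).continuousAt (by fun_prop)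
  have huc := hu.continuous
  have hxi : ∀ i, Continuous (fun x : EuclideanSpace ℝ (Fin d) => x i) := fun i =>
    (EuclideanSpace.proj i : EuclideanSpace ℝ (Fin d) →L[ℝ] ℝ).continuous
  let e : Fin d → EuclideanSpace ℝ (Fin d) := fun i => EuclideanSpace.single i 1
  have he : ∀ i, ‖e i‖ = 1 := fun i => by simp [e]
  have hcoord : ∀ (x : EuclideanSpace ℝ (Fin d)) i, |x i| ≤ ‖x‖ := fun x i => by
    simpa using PiLp.norm_apply_le x i
  have hF : ∀ i (x : EuclideanSpace ℝ (Fin d)), HasFDerivAt (fun x : EuclideanSpace ℝ (Fin d) => x i * φ (‖x‖ ^ 2))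
      (x i • (φ' (‖x‖ ^ 2) • (2 • (innerSL ℝ x))) + φ (‖x‖ ^ 2) • (EuclideanSpace.proj i : EuclideanSpace ℝ (Fin d) →L[ℝ] ℝ)) x := by
    intro i x
    have ha : HasFDerivAt (fun x : EuclideanSpace ℝ (Fin d) => x i) (EuclideanSpace.proj i : EuclideanSpace ℝ (Fin d) →L[ℝ] ℝ) x :=
      (EuclideanSpace.proj i : EuclideanSpace ℝ (Fin d) →L[ℝ] ℝ).hasFDerivAt
    have hb : HasFDerivAt (fun x : EuclideanSpace ℝ (Fin d) => φ (‖x‖ ^ 2)) (φ' (‖x‖ ^ 2) • (2 • (innerSL ℝ x))) x :=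
      HasDerivAt.comp_hasFDerivAt x (hφ (‖x‖ ^ 2) (sq_nonneg _)) (hasStrictFDerivAt_norm_sq x).hasFDerivAt
    exact ha.mul hb
  have hFe : ∀ i (x : EuclideanSpace ℝ (Fin d)), fderiv ℝ (fun x : EuclideanSpace ℝ (Fin d) => x i * φ (‖x‖ ^ 2)) x (e i)
      = φ (‖x‖ ^ 2) + 2 * ((x i)^2 * φ' (‖x‖ ^ 2)) := by
    intro i x
    rw [(hF i x).fderiv]
    simp [e, EuclideanSpace.inner_single_right]
    ring
  have I1 : ∀ i, Integrable (fun x => fderiv ℝ u x (e i) * (x i * φ (‖x‖ ^ 2))) := by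
    intro i
    refine h1.mono ?_ (Filter.Eventually.of_forall fun x => ?_)
    · refine ((measurable_fderiv_apply_const ℝ u (e i)).mul ?_).aestronglyMeasurable
      exact ((hxi i).mul hφc).measurable
    · simp only [norm_mul, norm_norm]
      have := (fderiv ℝ u x).le_opNorm (e i)
      rw [he, mul_one] at this
      gcongr
      exact hcoord x i
  have I2 : ∀ i, Integrable (fun x => u x * (x i * φ (‖x‖ ^ 2))) := by
    intro i
    refine h2.mono ?_ (Filter.Eventually.of_forall fun x => ?_)
    · exact (huc.mul ((hxi i).mul hφc)).aestronglyMeasurable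
    · simp only [norm_mul, norm_norm]
      gcongr
      exact hcoord x i
  have I3 : ∀ i, Integrable (fun x => u x * (φ (‖x‖ ^ 2) + 2 * ((x i)^2 * φ' (‖x‖ ^ 2)))) := by
    intro i
    have : Integrable (fun x => u x * ((x i)^2 * φ' (‖x‖ ^ 2))) := by
      refine h4.mono ?_ (Filter.Eventually.of_forall fun x => ?_)
      · exact (huc.mul (((hxi i).pow 2).mul hc)).aestronglyMeasurable
      · simp only [norm_mul, norm_norm, norm_pow]
        gcongr
        exact hcoord x i
    convert! h3.add (this.const_mul 2) using 2
    simp; ring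
  have key : ∀ i, ∫ x, (fderiv ℝ u x (e i) * (x i * φ (‖x‖ ^ 2)) + u x * (φ (‖x‖ ^ 2) + 2 * ((x i)^2 * φ' (‖x‖ ^ 2)))) = 0 := by
    intro i
    rw [integral_add (I1 i) (I3 i)]
    have := integral_mul_fderiv_eq_neg_fderiv_mul_of_integrable (μ := volume) (f := u)
      (g := fun x : EuclideanSpace ℝ (Fin d) => x i * φ (‖x‖ ^ 2)) (v := e i) (I1 i)
      (by simpa only [hFe] using I3 i) (I2 i) (fun x _ => hu x) (fun x _ => (hF i x).differentiableAt)
    simp only [hFe] at this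
    rw [this]; ring
  have hsum : ∀ x : EuclideanSpace ℝ (Fin d), fderiv ℝ u x x * φ (‖x‖ ^ 2)
      + u x * (d * φ (‖x‖ ^ 2) + 2 * (‖x‖ ^ 2 * φ' (‖x‖ ^ 2))) =
      ∑ i, (fderiv ℝ u x (e i) * (x i * φ (‖x‖ ^ 2)) + u x * (φ (‖x‖ ^ 2) + 2 * ((x i)^2 * φ' (‖x‖ ^ 2)))) := by
    intro x
    have hx : x = ∑ i, x i • e i := by
      ext j
      simp [e, Finset.sum_apply, Pi.single_apply]
    have h1 : fderiv ℝ u x x = ∑ i, x i * fderiv ℝ u x (e i) := by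
      conv_lhs => rw [hx, map_sum]
      rw [← hx]; simp
    have h2 : ‖x‖ ^ 2 = ∑ i, (x i)^2 := by
      rw [EuclideanSpace.norm_sq_eq]; simp
    rw [Finset.sum_add_distrib, ← Finset.mul_sum, Finset.sum_add_distrib, ← Finset.mul_sum, ← Finset.sum_mul, ← h2, h1]
    simp [Finset.sum_mul]
    exact Finset.sum_congr rfl fun i _ => by ring
  simp only [hsum]
  refine (integral_finsetSum _ fun i _ => (I1 i).add (I3 i)).trans ?_
  exact Finset.sum_eq_zero fun i _ => key i

lemma hp_seg {E : Type*} [NormedAddCommGroup E] [NormedSpace ℝ E] [MeasurableSpace E] [BorelSpace E]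
    [CompleteSpace E] [SecondCountableTopology E] (g : E → ℝ) (hg : Differentiable ℝ g) (x y : E) :
    ENNReal.ofReal ((g x - g y) ^ 2) ≤ ENNReal.ofReal (‖x - y‖ ^ 2) *
      ∫⁻ t in Set.Ioc (0:ℝ) 1, ENNReal.ofReal (‖fderiv ℝ g (t • x + (1 - t) • y)‖ ^ 2) := by
  rw [← lintegral_const_mul' _ _ ENNReal.ofReal_ne_top]
  let γ : ℝ → E := fun t => t • x + (1 - t) • y
  have hγ : ∀ t, HasDerivAt γ (x - y) t := by
    intro t
    have := ((hasDerivAt_id t).smul_const x).add (((hasDerivAt_id t).const_sub 1).smul_const y)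
    convert! this using 1
    simp [sub_eq_add_neg]
  have hγc : Continuous γ := by fun_prop
  let h' : ℝ → ℝ := fun t => fderiv ℝ g (γ t) (x - y)
  have hh : ∀ t, HasDerivAt (fun t => g (γ t)) (h' t) t := fun t =>
    (hg (γ t)).hasFDerivAt.comp_hasDerivAt t (hγ t)
  have hm : Measurable h' := (measurable_fderiv_apply_const ℝ g (x - y)).comp hγc.measurable
  have hle : ∫⁻ t in Set.Ioc (0:ℝ) 1, ENNReal.ofReal (h' t ^ 2) ≤
      ∫⁻ t in Set.Ioc (0:ℝ) 1, ENNReal.ofReal (‖x - y‖ ^ 2) * ENNReal.ofReal (‖fderiv ℝ g (t • x + (1 - t) • y)‖ ^ 2) := by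
    refine lintegral_mono fun t => ?_
    rw [← ENNReal.ofReal_mul (by positivity), ← mul_pow]
    apply ENNReal.ofReal_le_ofReal
    rw [← sq_abs]
    have := (fderiv ℝ g (γ t)).le_opNorm (x - y)
    rw [mul_comm] at this
    exact pow_le_pow_left₀ (abs_nonneg _) this 2
  refine le_trans ?_ hle
  by_cases hfin : ∫⁻ t in Set.Ioc (0:ℝ) 1, ENNReal.ofReal (h' t ^ 2) = ⊤
  · rw [hfin]; exact le_top
  have hI2 : IntegrableOn (fun t => h' t ^ 2) (Set.Ioc (0:ℝ) 1) := by
    refine ⟨(hm.pow_const 2).aestronglyMeasurable, ?_⟩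
    rw [hasFiniteIntegral_iff_ofReal (Filter.Eventually.of_forall fun t => sq_nonneg _)]
    exact lt_top_iff_ne_top.2 hfin
  have hI1 : IntegrableOn h' (Set.Ioc (0:ℝ) 1) := by
    have hone : IntegrableOn (fun _ : ℝ => (1:ℝ)) (Set.Ioc (0:ℝ) 1) := by simp
    refine (hI2.add hone).mono' hm.aestronglyMeasurable (Filter.Eventually.of_forall fun t => ?_)
    simp only [Pi.add_apply, Real.norm_eq_abs]
    nlinarith [sq_abs (h' t), sq_nonneg (|h' t| - 1)]
  have hftc : ∫ t in Set.Ioc (0:ℝ) 1, h' t = g x - g y := by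
    have := intervalIntegral.integral_eq_sub_of_hasDerivAt (f := fun t => g (γ t)) (f' := h') (a := 0) (b := 1)
      (fun t _ => hh t) ((intervalIntegrable_iff_integrableOn_Ioc_of_le zero_le_one).2 hI1)
    rw [intervalIntegral.integral_of_le zero_le_one] at this
    rw [this]; simp [γ]
  rw [← ofReal_integral_eq_lintegral_ofReal hI2 (Filter.Eventually.of_forall fun t => sq_nonneg _)]
  apply ENNReal.ofReal_le_ofReal
  set m := g x - g y
  have h0 : 0 ≤ ∫ t in Set.Ioc (0:ℝ) 1, (h' t - m) ^ 2 := integral_nonneg fun t => sq_nonneg _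
  have h1 : ∫ t in Set.Ioc (0:ℝ) 1, (h' t - m) ^ 2 = (∫ t in Set.Ioc (0:ℝ) 1, h' t ^ 2) - 2 * m * m + m ^ 2 := by
    have hcst : IntegrableOn (fun _ : ℝ => m ^ 2) (Set.Ioc (0:ℝ) 1) := by simp
    calc _ = ∫ t in Set.Ioc (0:ℝ) 1, (h' t ^ 2 - 2 * m * h' t + m ^ 2) := by
            congr 1; ext t; ring
      _ = _ := by
        refine (integral_add (hI2.sub (hI1.const_mul (2 * m))) hcst).trans ?_
        have e1 := integral_sub hI2 (hI1.const_mul (2 * m))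
        rw [integral_const_mul, hftc] at e1
        refine (congrArg₂ (· + ·) e1 rfl).trans ?_
        simp
  nlinarith

lemma hp_shift {d : ℕ} (G : EuclideanSpace ℝ (Fin d) → ENNReal) (hG : Measurable G)
    (t : ℝ) (ht : 1 / 2 ≤ t) (c : EuclideanSpace ℝ (Fin d)) :
    ∫⁻ x, G (t • x + c) ≤ 2 ^ d * ∫⁻ x, G x := by
  have ht0 : 0 < t := by linarith
  have h1 : ∫⁻ x, G (t • x + c) = ∫⁻ z, G (z + c) ∂(Measure.map (fun x => t • x) volume) := by
    rw [lintegral_map (by fun_prop) (by fun_prop)]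
  rw [h1, Measure.map_addHaar_smul _ ht0.ne', lintegral_smul_measure, lintegral_add_right_eq_self (fun z => G z) c]
  rw [smul_eq_mul]
  gcongr
  rw [abs_of_pos (by positivity)]
  have : (t ^ Module.finrank ℝ (EuclideanSpace ℝ (Fin d)))⁻¹ ≤ 2 ^ d := by
    rw [finrank_euclideanSpace_fin, ← inv_pow]
    apply pow_le_pow_left₀ (by positivity)
    rw [inv_le_comm₀ ht0 (by norm_num)]
    linarith
  calc _ ≤ ENNReal.ofReal (2 ^ d) := ENNReal.ofReal_le_ofReal this
    _ = 2 ^ d := by rw [ENNReal.ofReal_pow (by norm_num)]; simp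

lemma hp_ball {d : ℕ} (R : ℝ) (hR : 0 < R) (f : EuclideanSpace ℝ (Fin d) → ℝ)
    (hf : Differentiable ℝ f)
    (hNint : IntegrableOn (fun x => ‖fderiv ℝ f x‖ ^ 2) (Metric.closedBall 0 R)) :
    ∃ a : ℝ, ∫ x in Metric.closedBall 0 R, (f x - a) ^ 2 ≤
      (2 * R) ^ 2 * 2 ^ d * ∫ x in Metric.closedBall 0 R, ‖fderiv ℝ f x‖ ^ 2 := by
  set K : Set (EuclideanSpace ℝ (Fin d)) := Metric.closedBall 0 R with hK
  have hKm : MeasurableSet K := measurableSet_closedBall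
  have hK0 : volume K ≠ 0 := (Metric.measure_closedBall_pos _ _ hR).ne'
  have hKt : volume K ≠ ⊤ := measure_closedBall_lt_top.ne
  have hKc : Convex ℝ K := convex_closedBall _ _
  let G : EuclideanSpace ℝ (Fin d) → ENNReal := K.indicator fun x => ENNReal.ofReal (‖fderiv ℝ f x‖ ^ 2)
  have hG : Measurable G :=
    (((measurable_fderiv ℝ f).norm.pow_const 2).ennreal_ofReal).indicator hKm
  have hfc := hf.continuous
  let C : ENNReal := ENNReal.ofReal ((2 * R) ^ 2)
  have hpt : ∀ y ∈ K, ∀ x ∈ K, ENNReal.ofReal ((f x - f y) ^ 2) ≤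
      C * ∫⁻ t in Set.Ioc (0:ℝ) 1, G (t • x + (1 - t) • y) := by
    intro y hy x hx
    refine (hp_seg f hf x y).trans ?_
    gcongr ?_ * ?_
    · apply ENNReal.ofReal_le_ofReal
      have h1 : ‖x‖ ≤ R := by simpa [hK] using hx
      have h2 : ‖y‖ ≤ R := by simpa [hK] using hy
      have := norm_sub_le x y
      gcongr
      linarith
    · refine setLIntegral_mono' measurableSet_Ioc fun t ht => ?_
      have : t • x + (1 - t) • y ∈ K := hKc hx hy ht.1.le (by linarith [ht.2]) (by ring)
      simp only [G, Set.indicator_of_mem this]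
      exact le_rfl
  let Φ : EuclideanSpace ℝ (Fin d) → ENNReal := fun y => ∫⁻ x in K, ENNReal.ofReal ((f x - f y) ^ 2)
  have hΦm : Measurable Φ := by
    apply Measurable.lintegral_prod_right' (f := fun p : EuclideanSpace ℝ (Fin d) × EuclideanSpace ℝ (Fin d) => ENNReal.ofReal ((f p.2 - f p.1) ^ 2))
    exact (Continuous.measurable (by fun_prop)).ennreal_ofReal
  have hmt : ∀ t ∈ Set.Ioc (0:ℝ) 1, ∫⁻ y in K, ∫⁻ x in K, G (t • x + (1 - t) • y) ≤
      2 ^ d * (∫⁻ x, G x) * volume K := by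
    intro t ht
    rcases le_total (1/2) t with h | h
    · calc _ ≤ ∫⁻ y in K, 2 ^ d * (∫⁻ x, G x) :=
          lintegral_mono fun y => (setLIntegral_le_lintegral K _).trans (hp_shift G hG t h _)
        _ = _ := by rw [setLIntegral_const]
    · rw [lintegral_lintegral_swap (Measurable.aemeasurable (by
        apply hG.comp
        exact Continuous.measurable (by fun_prop)))]
      calc _ ≤ ∫⁻ y in K, 2 ^ d * (∫⁻ x, G x) := by
            refine lintegral_mono fun y => (setLIntegral_le_lintegral K _).trans ?_
            simp only [add_comm (t • y)]
            exact hp_shift G hG (1 - t) (by linarith) _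
        _ = _ := by rw [setLIntegral_const]
  have hΦ : ∫⁻ y in K, Φ y ≤ C * (2 ^ d * (∫⁻ x, G x) * volume K) := by
    calc _ ≤ ∫⁻ y in K, ∫⁻ x in K, C * ∫⁻ t in Set.Ioc (0:ℝ) 1, G (t • x + (1 - t) • y) :=
          setLIntegral_mono' hKm fun y hy => setLIntegral_mono' hKm fun x hx => hpt y hy x hx
      _ = C * ∫⁻ y in K, ∫⁻ x in K, ∫⁻ t in Set.Ioc (0:ℝ) 1, G (t • x + (1 - t) • y) := by
          rw [← lintegral_const_mul' _ _ ENNReal.ofReal_ne_top]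
          congr 1; ext y
          rw [← lintegral_const_mul' _ _ ENNReal.ofReal_ne_top]
      _ = C * ∫⁻ y in K, ∫⁻ t in Set.Ioc (0:ℝ) 1, ∫⁻ x in K, G (t • x + (1 - t) • y) := by
          congr 2; ext y
          rw [lintegral_lintegral_swap (Measurable.aemeasurable (by
            apply hG.comp
            exact Continuous.measurable (by fun_prop)))]
      _ = C * ∫⁻ t in Set.Ioc (0:ℝ) 1, ∫⁻ y in K, ∫⁻ x in K, G (t • x + (1 - t) • y) := by
          congr 1
          rw [lintegral_lintegral_swap (Measurable.aemeasurable ?_)]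
          apply Measurable.lintegral_prod_right' (f := fun p : (EuclideanSpace ℝ (Fin d) × ℝ) × EuclideanSpace ℝ (Fin d) => G (p.1.2 • p.2 + (1 - p.1.2) • p.1.1))
          apply hG.comp
          exact Continuous.measurable (by fun_prop)
      _ ≤ C * ∫⁻ t in Set.Ioc (0:ℝ) 1, 2 ^ d * (∫⁻ x, G x) * volume K := by
          gcongr 1
          exact setLIntegral_mono' measurableSet_Ioc hmt
      _ = _ := by rw [setLIntegral_const]; simp
  obtain ⟨y, hy, hle⟩ := exists_le_setLAverage hK0 hKt hΦm.aemeasurable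
  have hle2 : Φ y ≤ C * 2 ^ d * ∫⁻ x, G x := by
    refine hle.trans ?_
    rw [setLAverage_eq]
    refine ENNReal.div_le_of_le_mul (hΦ.trans (le_of_eq ?_))
    ring
  refine ⟨f y, ?_⟩
  have hGint : ∫⁻ x, G x = ENNReal.ofReal (∫ x in K, ‖fderiv ℝ f x‖ ^ 2) := by
    rw [ofReal_integral_eq_lintegral_ofReal hNint (Filter.Eventually.of_forall fun t => sq_nonneg _)]
    exact lintegral_indicator hKm _
  have hfI : IntegrableOn (fun x => (f x - f y) ^ 2) K :=
    ContinuousOn.integrableOn_compact (isCompact_closedBall _ _) (by fun_prop)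
  have hΦe : Φ y = ENNReal.ofReal (∫ x in K, (f x - f y) ^ 2) := by
    rw [ofReal_integral_eq_lintegral_ofReal hfI (Filter.Eventually.of_forall fun t => sq_nonneg _)]
  rw [hΦe, hGint] at hle2
  have h2 : (2:ENNReal) ^ d = ENNReal.ofReal (2 ^ d) := by
    rw [ENNReal.ofReal_pow (by norm_num)]; simp
  have hnn : 0 ≤ ∫ x in K, ‖fderiv ℝ f x‖ ^ 2 := integral_nonneg fun x => sq_nonneg _
  rw [h2, ← ENNReal.ofReal_mul (by positivity), ← ENNReal.ofReal_mul (by positivity)] at hle2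
  exact (ENNReal.ofReal_le_ofReal_iff (by positivity)).1 hle2

/-- Pointwise Young inequality. -/
lemma hp_young (δ D r a l N W : ℝ) (hδ : 0 < δ) (hD : 0 < D) (hW : 0 ≤ W)
    (hl : |l| ≤ N * r) :
    |2 * a * l * W| ≤ δ * (a ^ 2 * W) + δ⁻¹ * (N ^ 2 * ((D + r ^ 2) * W)) := by
  have h1 : |2 * a * l| ≤ δ * a ^ 2 + δ⁻¹ * (N ^ 2 * (D + r ^ 2)) := by
    have h2 : l ^ 2 ≤ N ^ 2 * (D + r ^ 2) := by
      have := pow_le_pow_left₀ (abs_nonneg _) hl 2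
      rw [sq_abs] at this
      nlinarith [mul_nonneg (sq_nonneg N) hD.le]
    have h3 : |2 * a * l| ≤ δ * a ^ 2 + δ⁻¹ * l ^ 2 := by
      have e1 : δ * a ^ 2 + δ⁻¹ * l ^ 2 - 2 * a * l = δ⁻¹ * (δ * a - l) ^ 2 := by field_simp; ring
      have e2 : δ * a ^ 2 + δ⁻¹ * l ^ 2 + 2 * a * l = δ⁻¹ * (δ * a + l) ^ 2 := by field_simp; ring
      have p1 : 0 ≤ δ⁻¹ * (δ * a - l) ^ 2 := by positivity
      have p2 : 0 ≤ δ⁻¹ * (δ * a + l) ^ 2 := by positivity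
      rw [abs_le]; constructor <;> linarith
    have h4 := mul_le_mul_of_nonneg_left h2 (inv_nonneg.2 hδ.le)
    linarith
  rw [abs_mul, abs_of_nonneg hW]
  have := mul_le_mul_of_nonneg_right h1 hW
  refine this.trans (le_of_eq ?_)
  ring

lemma hp_pow {D r α : ℝ} (hD : 0 < D) : (D + r ^ 2) ^ α = (D + r ^ 2) * (D + r ^ 2) ^ (α - 1) := by
  have h : 0 < D + r ^ 2 := by positivity
  rw [rpow_sub_one h.ne']; field_simp

lemma hp_identity {d : ℕ} (α D : ℝ) (hα : α < 0) (hD : 0 < D)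
    (g : EuclideanSpace ℝ (Fin d) → ℝ) (hg : Differentiable ℝ g)
    (hA : Integrable (fun x => g x ^ 2 * (D + ‖x‖ ^ 2) ^ (α - 1)))
    (hB : Integrable (fun x => ‖fderiv ℝ g x‖ ^ 2 * (D + ‖x‖ ^ 2) ^ α)) :
    Integrable (fun x => 2 * g x * fderiv ℝ g x x * (D + ‖x‖ ^ 2) ^ (α - 1)
      + ((d - 2 + 2 * α) + 2 * (1 - α) * (D / (D + ‖x‖ ^ 2))) * (g x ^ 2 * (D + ‖x‖ ^ 2) ^ (α - 1))) ∧
    ∫ x, (2 * g x * fderiv ℝ g x x * (D + ‖x‖ ^ 2) ^ (α - 1)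
      + ((d - 2 + 2 * α) + 2 * (1 - α) * (D / (D + ‖x‖ ^ 2))) * (g x ^ 2 * (D + ‖x‖ ^ 2) ^ (α - 1))) = 0 := by
  have hP : ∀ x : EuclideanSpace ℝ (Fin d), 0 < D + ‖x‖ ^ 2 := fun x => by positivity
  set W : EuclideanSpace ℝ (Fin d) → ℝ := fun x => (D + ‖x‖ ^ 2) ^ (α - 1) with hW
  have hW0 : ∀ x, 0 < W x := fun x => rpow_pos_of_pos (hP x) _
  have hWc : Continuous W :=
    Continuous.rpow_const (by fun_prop) (fun x => Or.inl (hP x).ne')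
  have hB' : Integrable (fun x => ‖fderiv ℝ g x‖ ^ 2 * ((D + ‖x‖ ^ 2) * W x)) := by
    refine hB.congr (Filter.Eventually.of_forall fun x => ?_)
    change ‖fderiv ℝ g x‖ ^ 2 * (D + ‖x‖ ^ 2) ^ α = ‖fderiv ℝ g x‖ ^ 2 * ((D + ‖x‖ ^ 2) * (D + ‖x‖ ^ 2) ^ (α - 1))
    rw [← hp_pow hD]
  have hgc := hg.continuous
  have hfm : Measurable (fderiv ℝ g) := measurable_fderiv ℝ g
  have hlm : Measurable (fun x => fderiv ℝ g x x) := by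
    have : Continuous (fun p : (EuclideanSpace ℝ (Fin d) →L[ℝ] ℝ) × EuclideanSpace ℝ (Fin d) => p.1 p.2) :=
      isBoundedBilinearMap_apply.continuous
    exact this.measurable.comp (hfm.prodMk measurable_id)
  have hl : ∀ x, |fderiv ℝ g x x| ≤ ‖fderiv ℝ g x‖ * ‖x‖ := fun x => (fderiv ℝ g x).le_opNorm x
  have hq : ∀ x : EuclideanSpace ℝ (Fin d), 0 ≤ D / (D + ‖x‖ ^ 2) ∧ D / (D + ‖x‖ ^ 2) ≤ 1 := fun x =>
    ⟨(div_pos hD (hP x)).le, (div_le_one (hP x)).2 (by nlinarith [sq_nonneg ‖x‖])⟩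
  have hPc : Continuous (fun x : EuclideanSpace ℝ (Fin d) => D / (D + ‖x‖ ^ 2)) :=
    Continuous.div (by fun_prop) (by fun_prop) (fun x => (hP x).ne')
  set H : EuclideanSpace ℝ (Fin d) → ℝ := fun x => 2 * g x * fderiv ℝ g x x * W x
      + ((d - 2 + 2 * α) + 2 * (1 - α) * (D / (D + ‖x‖ ^ 2))) * (g x ^ 2 * W x) with hH
  have hHm : Measurable H := by
    refine (((hgc.measurable.const_mul 2).mul hlm).mul hWc.measurable).add ?_
    exact Continuous.measurable (by fun_prop)
  have hHi : Integrable H := by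
    refine Integrable.add ?_ ?_
    · refine ((hA.const_mul 1).add (hB'.const_mul (1:ℝ)⁻¹)).mono'
        (((hgc.measurable.const_mul 2).mul hlm).mul hWc.measurable).aestronglyMeasurable
        (Filter.Eventually.of_forall fun x => ?_)
      exact hp_young 1 D ‖x‖ (g x) _ _ (W x) one_pos hD (hW0 x).le (hl x)
    · refine (hA.const_mul (|(d - 2 + 2 * α)| + 2 * (1 - α))).mono'
        (Continuous.aestronglyMeasurable (by fun_prop)) (Filter.Eventually.of_forall fun x => ?_)
      have h0 : 0 ≤ g x ^ 2 * W x := mul_nonneg (sq_nonneg _) (hW0 x).le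
      rw [norm_mul, Real.norm_of_nonneg h0]
      refine mul_le_mul_of_nonneg_right ?_ h0
      refine (norm_add_le _ _).trans ?_
      rw [Real.norm_eq_abs, Real.norm_of_nonneg (mul_nonneg (by linarith) (hq x).1)]
      nlinarith [hq x]
  refine ⟨hHi, ?_⟩
  -- the regularised identity
  let F : ℝ → EuclideanSpace ℝ (Fin d) → ℝ := fun ε x =>
    H x * (1 + ε * ‖x‖ ^ 2)⁻¹ - 2 * (g x ^ 2 * W x) * (ε * ‖x‖ ^ 2 / (1 + ε * ‖x‖ ^ 2) ^ 2)
  have hu : Differentiable ℝ (fun x => g x ^ 2) := hg.pow 2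
  have hfu : ∀ x, fderiv ℝ (fun x => g x ^ 2) x = (2 * g x) • fderiv ℝ g x := by
    intro x
    rw [((hg x).hasFDerivAt.pow 2).fderiv]
    simp
  have hQ : ∀ ε : ℝ, 0 < ε → ∀ x : EuclideanSpace ℝ (Fin d), 1 ≤ 1 + ε * ‖x‖ ^ 2 := fun ε hε x => by
    have : 0 ≤ ε * ‖x‖ ^ 2 := by positivity
    linarith
  have hreg : ∀ ε : ℝ, 0 < ε → ∫ x, F ε x = 0 := by
    intro ε hε
    let φ : ℝ → ℝ := fun s => (D + s) ^ (α - 1) * (1 + ε * s)⁻¹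
    let φ' : ℝ → ℝ := fun s => (α - 1) * ((D + s) ^ (α - 1) / (D + s)) * (1 + ε * s)⁻¹
      - (D + s) ^ (α - 1) * (ε / (1 + ε * s) ^ 2)
    have hφ : ∀ s, 0 ≤ s → HasDerivAt φ (φ' s) s := by
      intro s hs
      have hDs : 0 < D + s := by linarith
      have hes : 0 < 1 + ε * s := by positivity
      have a1 : HasDerivAt (fun s => D + s) 1 s := (hasDerivAt_id s).const_add D
      have a2 : HasDerivAt (fun s => 1 + ε * s) ε s := by
        simpa using ((hasDerivAt_id s).const_mul ε).const_add 1
      have b1 := a1.rpow_const (p := α - 1) (Or.inl hDs.ne')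
      have b2 := a2.inv hes.ne'
      convert! b1.mul b2 using 1
      rw [rpow_sub_one hDs.ne' (α - 1)]
      simp only [φ', Pi.inv_apply]
      ring
    have hQc : Continuous (fun x : EuclideanSpace ℝ (Fin d) => (1 + ε * ‖x‖ ^ 2)⁻¹) :=
      Continuous.inv₀ (by fun_prop) (fun x => by linarith [hQ ε hε x])
    have hQc2 : Continuous (fun x : EuclideanSpace ℝ (Fin d) => ε / (1 + ε * ‖x‖ ^ 2) ^ 2) :=
      Continuous.div (by fun_prop) (by fun_prop) (fun x => by have := hQ ε hε x; positivity)
    have hWPc : Continuous (fun x : EuclideanSpace ℝ (Fin d) => W x / (D + ‖x‖ ^ 2)) :=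
      Continuous.div hWc (by fun_prop) (fun x => (hP x).ne')
    have hφc' : Continuous (fun x : EuclideanSpace ℝ (Fin d) => φ' (‖x‖ ^ 2)) :=
      ((hWPc.const_mul (α - 1)).mul hQc).sub (hWc.mul hQc2)
    have hφc : Continuous (fun x : EuclideanSpace ℝ (Fin d) => φ (‖x‖ ^ 2)) := hWc.mul hQc
    have hφW : ∀ x : EuclideanSpace ℝ (Fin d), 0 ≤ φ (‖x‖ ^ 2) ∧ φ (‖x‖ ^ 2) ≤ W x := by
      intro x
      have := hQ ε hε x
      exact ⟨mul_nonneg (hW0 x).le (by positivity), mul_le_of_le_one_right (hW0 x).le (inv_le_one_of_one_le₀ this)⟩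
    have key := hp_ibp (fun x => g x ^ 2) hu φ φ' hφ hφc' ?_ ?_ ?_ ?_
    · rw [← key]
      congr 1; ext x
      have hp := (hP x).ne'
      have hq' : 1 + ε * ‖x‖ ^ 2 ≠ 0 := by linarith [hQ ε hε x]
      rw [hfu]
      simp only [F, H, φ, φ', smul_apply, smul_eq_mul]
      change (2 * g x * fderiv ℝ g x x * W x
        + ((d - 2 + 2 * α) + 2 * (1 - α) * (D / (D + ‖x‖ ^ 2))) * (g x ^ 2 * W x)) * (1 + ε * ‖x‖ ^ 2)⁻¹
        - 2 * (g x ^ 2 * W x) * (ε * ‖x‖ ^ 2 / (1 + ε * ‖x‖ ^ 2) ^ 2) =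
        2 * g x * fderiv ℝ g x x * (W x * (1 + ε * ‖x‖ ^ 2)⁻¹) + g x ^ 2 * (d * (W x * (1 + ε * ‖x‖ ^ 2)⁻¹) +
          2 * (‖x‖ ^ 2 * ((α - 1) * (W x / (D + ‖x‖ ^ 2)) * (1 + ε * ‖x‖ ^ 2)⁻¹
            - W x * (ε / (1 + ε * ‖x‖ ^ 2) ^ 2))))
      generalize W x = w
      field_simp
      ring
    · refine ((hA.const_mul 1).add (hB'.const_mul (1:ℝ)⁻¹)).mono' ?_ (Filter.Eventually.of_forall fun x => ?_)
      · exact ((measurable_fderiv ℝ _).norm.mul (continuous_norm.mul hφc).measurable).aestronglyMeasurable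
      · have := hp_young 1 D ‖x‖ (g x) (‖fderiv ℝ g x‖ * ‖x‖) ‖fderiv ℝ g x‖ (W x) one_pos hD (hW0 x).le
          (by rw [abs_of_nonneg (by positivity)])
        refine le_trans ?_ this
        rw [hfu, norm_smul]
        have h0 : 0 ≤ φ (‖x‖ ^ 2) := (hφW x).1
        simp only [norm_mul, abs_mul, Real.norm_eq_abs, abs_norm, abs_abs]
        rw [abs_of_nonneg h0, abs_of_pos (hW0 x)]
        have := mul_le_mul_of_nonneg_left (hφW x).2 (show 0 ≤ |2| * |g x| * (‖fderiv ℝ g x‖ * ‖x‖) by positivity)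
        refine le_trans (le_of_eq ?_) this
        ring
    · refine (hA.const_mul (1 + 1 / ε)).mono' ?_ (Filter.Eventually.of_forall fun x => ?_)
      · exact ((hgc.pow 2).mul (continuous_norm.mul hφc)).aestronglyMeasurable
      · have h0 : 0 ≤ φ (‖x‖ ^ 2) := (hφW x).1
        rw [Real.norm_of_nonneg (by positivity)]
        have h1 : ‖x‖ * (1 + ε * ‖x‖ ^ 2)⁻¹ ≤ 1 + 1 / ε := by
          have hq := hQ ε hε x
          rw [← div_eq_mul_inv, div_le_iff₀ (by linarith)]
          have : (1 + 1 / ε) * (1 + ε * ‖x‖ ^ 2) = 1 + ε * ‖x‖ ^ 2 + 1 / ε + ‖x‖ ^ 2 := by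
            field_simp; ring
          rw [this]
          have : 0 < 1 / ε := by positivity
          nlinarith [sq_nonneg (‖x‖ - 1)]
        have := mul_le_mul_of_nonneg_left h1 (show 0 ≤ g x ^ 2 * W x from mul_nonneg (sq_nonneg _) (hW0 x).le)
        have e : g x ^ 2 * (‖x‖ * φ (‖x‖ ^ 2)) = g x ^ 2 * W x * (‖x‖ * (1 + ε * ‖x‖ ^ 2)⁻¹) := by
          change g x ^ 2 * (‖x‖ * (W x * (1 + ε * ‖x‖ ^ 2)⁻¹)) = _
          ring
        rw [e]
        linarith
    · refine hA.mono' ?_ (Filter.Eventually.of_forall fun x => ?_)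
      · exact ((hgc.pow 2).mul hφc).aestronglyMeasurable
      · have h0 : 0 ≤ φ (‖x‖ ^ 2) := (hφW x).1
        rw [Real.norm_of_nonneg (by positivity)]
        exact mul_le_mul_of_nonneg_left (hφW x).2 (sq_nonneg _)
    · refine (hA.const_mul (2 - α)).mono' ?_ (Filter.Eventually.of_forall fun x => ?_)
      · exact ((hgc.pow 2).mul ((continuous_norm.pow 2).mul hφc')).aestronglyMeasurable
      · have hq := hQ ε hε x
        have hq0 : 0 < 1 + ε * ‖x‖ ^ 2 := by linarith
        have e : g x ^ 2 * (‖x‖ ^ 2 * φ' (‖x‖ ^ 2)) = - ((g x ^ 2 * W x) *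
            ((1 - α) * (‖x‖ ^ 2 / (D + ‖x‖ ^ 2) * (1 + ε * ‖x‖ ^ 2)⁻¹)
              + ε * ‖x‖ ^ 2 / (1 + ε * ‖x‖ ^ 2) ^ 2)) := by
          change g x ^ 2 * (‖x‖ ^ 2 * ((α - 1) * (W x / (D + ‖x‖ ^ 2)) * (1 + ε * ‖x‖ ^ 2)⁻¹
            - W x * (ε / (1 + ε * ‖x‖ ^ 2) ^ 2))) = _
          ring
        have p1 : ‖x‖ ^ 2 / (D + ‖x‖ ^ 2) ≤ 1 := (div_le_one (hP x)).2 (by linarith)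
        have p2 : (1 + ε * ‖x‖ ^ 2)⁻¹ ≤ 1 := inv_le_one_of_one_le₀ hq
        have p3 : ε * ‖x‖ ^ 2 / (1 + ε * ‖x‖ ^ 2) ^ 2 ≤ 1 := by
          rw [div_le_one (by positivity)]; nlinarith
        have p4 : 0 ≤ ε * ‖x‖ ^ 2 / (1 + ε * ‖x‖ ^ 2) ^ 2 := by positivity
        have p5 : 0 ≤ ‖x‖ ^ 2 / (D + ‖x‖ ^ 2) := div_nonneg (sq_nonneg _) (hP x).le
        have p6 : 0 ≤ (1 + ε * ‖x‖ ^ 2)⁻¹ := by positivity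
        have p7 : ‖x‖ ^ 2 / (D + ‖x‖ ^ 2) * (1 + ε * ‖x‖ ^ 2)⁻¹ ≤ 1 := mul_le_one₀ p1 p6 p2
        have p8 := mul_nonneg p5 p6
        have h0 : 0 ≤ g x ^ 2 * W x := mul_nonneg (sq_nonneg _) (hW0 x).le
        have hα1 : 0 ≤ 1 - α := by linarith
        rw [e, norm_neg, Real.norm_of_nonneg (by positivity), mul_comm]
        refine mul_le_mul_of_nonneg_right ?_ h0
        nlinarith
  have hlim : Filter.Tendsto (fun n : ℕ => ∫ x, F (1 / ((n:ℝ) + 1)) x) Filter.atTop (nhds (∫ x, H x)) := by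
    refine tendsto_integral_of_dominated_convergence (fun x => |H x| + 2 * (g x ^ 2 * W x)) ?_
      (hHi.abs.add (hA.const_mul 2)) ?_ ?_
    · intro n
      refine Measurable.aestronglyMeasurable ?_
      refine (hHm.mul (by fun_prop)).sub (Measurable.mul (Continuous.measurable (by fun_prop)) (by fun_prop))
    · intro n
      refine Filter.Eventually.of_forall fun x => ?_
      have hε : (0:ℝ) < 1 / ((n:ℝ) + 1) := by positivity
      simp only [F]
      generalize 1 / ((n:ℝ) + 1) = ε at hε
      have hq := hQ ε hε x
      have p2 : (1 + ε * ‖x‖ ^ 2)⁻¹ ≤ 1 := inv_le_one_of_one_le₀ hq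
      have p3 : ε * ‖x‖ ^ 2 / (1 + ε * ‖x‖ ^ 2) ^ 2 ≤ 1 := by
        rw [div_le_one (by positivity)]; nlinarith
      have p4 : 0 ≤ ε * ‖x‖ ^ 2 / (1 + ε * ‖x‖ ^ 2) ^ 2 := by positivity
      have h0 : 0 ≤ g x ^ 2 * W x := mul_nonneg (sq_nonneg _) (hW0 x).le
      refine (norm_sub_le _ _).trans (add_le_add ?_ ?_)
      · rw [norm_mul, Real.norm_eq_abs, Real.norm_of_nonneg (by positivity)]
        exact mul_le_of_le_one_right (abs_nonneg _) p2
      · rw [Real.norm_of_nonneg (by positivity)]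
        exact mul_le_of_le_one_right (by positivity) p3
    · refine Filter.Eventually.of_forall fun x => ?_
      have hc : ContinuousAt (fun ε : ℝ => F ε x) 0 := by
        simp only [F]
        refine ContinuousAt.sub (ContinuousAt.mul continuousAt_const (ContinuousAt.inv₀ (by fun_prop) (by simp)))
          (ContinuousAt.mul continuousAt_const (ContinuousAt.div (by fun_prop) (by fun_prop) (by simp)))
      have h0 : F 0 x = H x := by simp [F]
      have := hc.tendsto.comp (tendsto_one_div_add_atTop_nhds_zero_nat (𝕜 := ℝ))
      rw [h0] at this
      exact this
  have hz : (fun n : ℕ => ∫ x, F (1 / ((n:ℝ) + 1)) x) = fun _ => 0 := by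
    ext n; exact hreg _ (by positivity)
  rw [hz] at hlim
  exact (tendsto_nhds_unique hlim tendsto_const_nhds)

lemma hp_integrable_weight {d : ℕ} (α D : ℝ) (hα : (d : ℝ) - 2 + 2 * α < 0) (hα0 : α < 0) (hD : 0 < D) :
    Integrable (fun x : EuclideanSpace ℝ (Fin d) => (D + ‖x‖ ^ 2) ^ (α - 1)) := by
  have h1 := integrable_rpow_neg_one_add_norm_sq (E := EuclideanSpace ℝ (Fin d)) (μ := volume)
    (r := 2 * (1 - α)) (by rw [finrank_euclideanSpace_fin]; linarith)
  refine (h1.const_mul ((min D 1) ^ (α - 1))).mono' ?_ (Filter.Eventually.of_forall fun x => ?_)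
  · exact (Continuous.rpow_const (by fun_prop) (fun x => Or.inl (by positivity))).aestronglyMeasurable
  · have hm : 0 < min D 1 := lt_min hD one_pos
    rw [Real.norm_of_nonneg (by positivity), show -(2 * (1 - α)) / 2 = α - 1 by ring,
      ← mul_rpow hm.le (by positivity)]
    refine rpow_le_rpow_of_nonpos (by positivity) ?_ (by linarith)
    have := min_le_left D 1
    have := min_le_right D 1
    nlinarith [sq_nonneg ‖x‖]

lemma hp_pos {d : ℕ} (α D : ℝ) (hα : α < 0) (hD : 0 < D) (hk : 0 < (d : ℝ) - 2 + 2 * α)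
    (g : EuclideanSpace ℝ (Fin d) → ℝ) (hg : Differentiable ℝ g)
    (hA : Integrable (fun x => g x ^ 2 * (D + ‖x‖ ^ 2) ^ (α - 1)))
    (hB : Integrable (fun x => ‖fderiv ℝ g x‖ ^ 2 * (D + ‖x‖ ^ 2) ^ α)) :
    (((d : ℝ) - 2 + 2 * α) ^ 2 / 4) * ∫ x, g x ^ 2 * (D + ‖x‖ ^ 2) ^ (α - 1) ≤
      ∫ x, ‖fderiv ℝ g x‖ ^ 2 * (D + ‖x‖ ^ 2) ^ α := by
  obtain ⟨hHi, hH⟩ := hp_identity α D hα hD g hg hA hB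
  set κ := (d : ℝ) - 2 + 2 * α
  have hle := integral_mono ((hA.const_mul (κ / 2)).sub (hB.const_mul (κ / 2)⁻¹)) hHi (fun x => by
    have hy := hp_young (κ / 2) D ‖x‖ (g x) (fderiv ℝ g x x) ‖fderiv ℝ g x‖ ((D + ‖x‖ ^ 2) ^ (α - 1)) (by positivity) hD
      (by positivity) ((fderiv ℝ g x).le_opNorm x)
    rw [← hp_pow hD] at hy
    have h0 : 0 ≤ (2 * (1 - α) * (D / (D + ‖x‖ ^ 2))) * (g x ^ 2 * (D + ‖x‖ ^ 2) ^ (α - 1)) := by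
      have : 0 ≤ 1 - α := by linarith
      positivity
    have := (abs_le.1 hy).1
    simp only [Pi.sub_apply]
    linarith)
  rw [hH] at hle
  have e := integral_sub (hA.const_mul (κ / 2)) (hB.const_mul (κ / 2)⁻¹)
  rw [integral_const_mul, integral_const_mul] at e
  have hle2 := e.symm.le.trans hle
  have h3 := mul_le_mul_of_nonneg_left (sub_nonpos.1 hle2) (show 0 ≤ κ / 2 by positivity)
  rw [← mul_assoc, ← mul_assoc, mul_inv_cancel₀ (by positivity), one_mul] at h3
  refine le_trans (le_of_eq ?_) h3
  ring

lemma hp_neg {d : ℕ} (α D : ℝ) (hα : α < 0) (hD : 0 < D) (k : ℝ) (hk : k = -((d : ℝ) - 2 + 2 * α)) (hk0 : 0 < k)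
    (f : EuclideanSpace ℝ (Fin d) → ℝ) (hf : Differentiable ℝ f)
    (hA : Integrable (fun x => f x ^ 2 * (D + ‖x‖ ^ 2) ^ (α - 1)))
    (hB : Integrable (fun x => ‖fderiv ℝ f x‖ ^ 2 * (D + ‖x‖ ^ 2) ^ α))
    (hI : Integrable (fun x => f x * (D + ‖x‖ ^ 2) ^ (α - 1)))
    (hz : (∫ x, f x * (D + ‖x‖ ^ 2) ^ (α - 1)) = 0)
    (σ : ℝ) (hσ : σ = 8 * (1 - α) / k) :
    (k / 2) * ∫ x, f x ^ 2 * (D + ‖x‖ ^ 2) ^ (α - 1) ≤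
      (4 / k + 2 * (1 - α) * (4 * σ * 2 ^ d) * (1 + σ) ^ (-α)) * ∫ x, ‖fderiv ℝ f x‖ ^ 2 * (D + ‖x‖ ^ 2) ^ α := by
  have hα1 : 0 < 1 - α := by linarith
  have hσ0 : 0 < σ := by rw [hσ]; positivity
  set R : ℝ := √(σ * D) with hRdef
  have hR : 0 < R := Real.sqrt_pos.2 (by positivity)
  have hR2 : R ^ 2 = σ * D := Real.sq_sqrt (by positivity)
  set K : Set (EuclideanSpace ℝ (Fin d)) := Metric.closedBall 0 R with hKdef
  have hKm : MeasurableSet K := measurableSet_closedBall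
  have hmem : ∀ x : EuclideanSpace ℝ (Fin d), x ∈ K ↔ ‖x‖ ^ 2 ≤ σ * D := by
    intro x
    rw [hKdef, mem_closedBall_zero_iff, ← hR2, sq_le_sq₀ (norm_nonneg _) hR.le]
  set c : ℝ := (D * (1 + σ)) ^ (-α) with hc
  have hKB : ∀ x ∈ K, ‖fderiv ℝ f x‖ ^ 2 ≤ c * (‖fderiv ℝ f x‖ ^ 2 * (D + ‖x‖ ^ 2) ^ α) := by
    intro x hx
    have h1 : (D * (1 + σ)) ^ α ≤ (D + ‖x‖ ^ 2) ^ α :=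
      rpow_le_rpow_of_nonpos (by positivity) (by nlinarith [(hmem x).1 hx]) hα.le
    have h2 : c * (D * (1 + σ)) ^ α = 1 := by
      rw [hc, ← rpow_add (by positivity)]; simp
    have h3 : 1 ≤ c * (D + ‖x‖ ^ 2) ^ α := by
      rw [← h2]; gcongr
    nlinarith [mul_le_mul_of_nonneg_left h3 (sq_nonneg ‖fderiv ℝ f x‖)]
  have hNK : IntegrableOn (fun x => ‖fderiv ℝ f x‖ ^ 2) K := by
    refine ((hB.const_mul c).integrableOn (s := K)).mono'
      ((measurable_fderiv ℝ f).norm.pow_const 2).aestronglyMeasurable ?_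
    refine (ae_restrict_iff' hKm).2 (Filter.Eventually.of_forall fun x hx => ?_)
    rw [Real.norm_of_nonneg (by positivity)]
    exact hKB x hx
  have hNle : ∫ x in K, ‖fderiv ℝ f x‖ ^ 2 ≤ c * ∫ x, ‖fderiv ℝ f x‖ ^ 2 * (D + ‖x‖ ^ 2) ^ α := by
    calc _ ≤ ∫ x in K, c * (‖fderiv ℝ f x‖ ^ 2 * (D + ‖x‖ ^ 2) ^ α) :=
          setIntegral_mono_on hNK (hB.const_mul c).integrableOn hKm hKB
      _ ≤ ∫ x, c * (‖fderiv ℝ f x‖ ^ 2 * (D + ‖x‖ ^ 2) ^ α) :=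
          setIntegral_le_integral (hB.const_mul c) (Filter.Eventually.of_forall fun x => by positivity)
      _ = _ := integral_const_mul _ _
  obtain ⟨a, ha⟩ := hp_ball R hR f hf hNK
  let g : EuclideanSpace ℝ (Fin d) → ℝ := fun x => f x - a
  have hg : Differentiable ℝ g := hf.sub_const a
  have hgf : ∀ x, fderiv ℝ g x = fderiv ℝ f x := fun x => fderiv_sub_const a
  have hw := hp_integrable_weight (d := d) α D (by linarith) hα hD
  have hexp : ∀ x : EuclideanSpace ℝ (Fin d), g x ^ 2 * (D + ‖x‖ ^ 2) ^ (α - 1) = f x ^ 2 * (D + ‖x‖ ^ 2) ^ (α - 1)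
      - 2 * a * (f x * (D + ‖x‖ ^ 2) ^ (α - 1)) + a ^ 2 * (D + ‖x‖ ^ 2) ^ (α - 1) := fun x => by
    simp only [g]; ring
  have hA' : Integrable (fun x => g x ^ 2 * (D + ‖x‖ ^ 2) ^ (α - 1)) := by
    simp only [hexp]
    exact (hA.sub (hI.const_mul _)).add (hw.const_mul _)
  have hB' : Integrable (fun x => ‖fderiv ℝ g x‖ ^ 2 * (D + ‖x‖ ^ 2) ^ α) := by
    simpa only [hgf] using hB
  have hAA : ∫ x, f x ^ 2 * (D + ‖x‖ ^ 2) ^ (α - 1) ≤ ∫ x, g x ^ 2 * (D + ‖x‖ ^ 2) ^ (α - 1) := by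
    have e1 : ∫ x, g x ^ 2 * (D + ‖x‖ ^ 2) ^ (α - 1) = (∫ x, f x ^ 2 * (D + ‖x‖ ^ 2) ^ (α - 1))
      - 2 * a * (∫ x, f x * (D + ‖x‖ ^ 2) ^ (α - 1)) + a ^ 2 * ∫ x : EuclideanSpace ℝ (Fin d), (D + ‖x‖ ^ 2) ^ (α - 1) := by
      simp only [hexp]
      rw [← integral_const_mul, ← integral_const_mul, ← integral_sub hA (hI.const_mul _)]
      exact integral_add (hA.sub (hI.const_mul _)) (hw.const_mul _)
    have e2 : 0 ≤ ∫ x : EuclideanSpace ℝ (Fin d), (D + ‖x‖ ^ 2) ^ (α - 1) := integral_nonneg fun x => by positivity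
    rw [e1, hz]
    nlinarith [mul_nonneg (sq_nonneg a) e2]
  obtain ⟨hHi, hH⟩ := hp_identity α D hα hD g hg hA' hB'
  have hgK : IntegrableOn (fun x => g x ^ 2) K :=
    ContinuousOn.integrableOn_compact (isCompact_closedBall _ _) (hg.continuous.pow 2).continuousOn
  have hgKi : Integrable (K.indicator fun x => g x ^ 2) := (integrable_indicator_iff hKm).2 hgK
  set m : ℝ := 2 * (1 - α) * D ^ (α - 1) with hm
  have hm0 : 0 ≤ m := by positivity
  have hle := integral_mono hHi (((hA'.const_mul (-(k / 2))).add (hB'.const_mul (k / 4)⁻¹)).add (hgKi.const_mul m)) (fun x => by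
    have hW0 : 0 < (D + ‖x‖ ^ 2) ^ (α - 1) := by positivity
    have hy := hp_young (k / 4) D ‖x‖ (g x) (fderiv ℝ g x x) ‖fderiv ℝ g x‖ ((D + ‖x‖ ^ 2) ^ (α - 1)) (by positivity) hD
      hW0.le ((fderiv ℝ g x).le_opNorm x)
    rw [← hp_pow hD] at hy
    have hkey : (2 * (1 - α) * (D / (D + ‖x‖ ^ 2))) * (g x ^ 2 * (D + ‖x‖ ^ 2) ^ (α - 1)) ≤
        k / 4 * (g x ^ 2 * (D + ‖x‖ ^ 2) ^ (α - 1)) + m * K.indicator (fun x => g x ^ 2) x := by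
      by_cases hx : x ∈ K
      · rw [Set.indicator_of_mem hx]
        have h1 : D / (D + ‖x‖ ^ 2) ≤ 1 := (div_le_one (by positivity)).2 (by nlinarith [sq_nonneg ‖x‖])
        have h2 : (D + ‖x‖ ^ 2) ^ (α - 1) ≤ D ^ (α - 1) :=
          rpow_le_rpow_of_nonpos hD (by nlinarith [sq_nonneg ‖x‖]) (by linarith)
        have h3 : (2 * (1 - α) * (D / (D + ‖x‖ ^ 2))) * (g x ^ 2 * (D + ‖x‖ ^ 2) ^ (α - 1)) ≤
            (2 * (1 - α) * 1) * (g x ^ 2 * D ^ (α - 1)) := by gcongr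
        have h4 : 0 ≤ k / 4 * (g x ^ 2 * (D + ‖x‖ ^ 2) ^ (α - 1)) := by positivity
        rw [hm]
        linarith
      · rw [Set.indicator_of_notMem hx, mul_zero, add_zero]
        refine mul_le_mul_of_nonneg_right ?_ (by positivity)
        have h1 : σ * D < ‖x‖ ^ 2 := by
          by_contra h; exact hx ((hmem x).2 (not_lt.1 h))
        rw [← mul_div_assoc, div_le_iff₀ (by positivity)]
        have h2 : σ * k = 8 * (1 - α) := by rw [hσ]; field_simp
        nlinarith [mul_lt_mul_of_pos_right h1 hk0, mul_pos hk0 hD]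
    have := (abs_le.1 hy).2
    have h5 : ((d : ℝ) - 2 + 2 * α) = -k := by linarith
    simp only [Pi.add_apply, h5]
    linarith)
  rw [hH] at hle
  have e := integral_add ((hA'.const_mul (-(k / 2))).add (hB'.const_mul (k / 4)⁻¹)) (hgKi.const_mul m)
  have e' := integral_add (hA'.const_mul (-(k / 2))) (hB'.const_mul (k / 4)⁻¹)
  rw [integral_const_mul, integral_const_mul] at e'
  rw [integral_const_mul, integral_indicator hKm] at e
  have hle2 := hle.trans (e.trans (congrArg (· + _) e')).le
  simp only [hgf] at hle2
  have hcc : m * ((2 * R) ^ 2 * 2 ^ d * c) = 2 * (1 - α) * (4 * σ * 2 ^ d) * (1 + σ) ^ (-α) := by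
    have h1 : D ^ (α - 1) * D * D ^ (-α) = 1 := by
      rw [← rpow_add_one hD.ne', ← rpow_add hD]; simp
    rw [hm, hc, mul_rpow hD.le (by positivity), mul_pow, hR2]
    linear_combination (2 * (1 - α) * (4 * σ * 2 ^ d) * (1 + σ) ^ (-α)) * h1
  have hKfin : m * ∫ x in K, g x ^ 2 ≤ 2 * (1 - α) * (4 * σ * 2 ^ d) * (1 + σ) ^ (-α) *
      ∫ x, ‖fderiv ℝ f x‖ ^ 2 * (D + ‖x‖ ^ 2) ^ α := by
    rw [← hcc, mul_assoc m]
    refine mul_le_mul_of_nonneg_left (ha.trans ?_) hm0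
    rw [mul_assoc _ c]
    exact mul_le_mul_of_nonneg_left hNle (by positivity)
  have h4k : (k / 4)⁻¹ = 4 / k := by rw [inv_div]
  rw [h4k] at hle2
  have hfin := mul_le_mul_of_nonneg_left hAA (show 0 ≤ k / 2 by positivity)
  rw [add_mul]
  linarith

theorem stmt4 (d : ℕ) (hd : 1 ≤ d) (α : ℝ) (hα : α < 0)
    (hne : 3 ≤ d → α ≠ (2 - (d : ℝ)) / 2) :
    ∃ Λ : ℝ, 0 < Λ ∧
      ∀ D : ℝ, 0 < D →
        ∀ f : EuclideanSpace ℝ (Fin d) → ℝ, Differentiable ℝ f →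
          Integrable (fun x => |f x| ^ 2 * (D + ‖x‖ ^ 2) ^ (α - 1)) →
          Integrable (fun x => ‖gradient f x‖ ^ 2 * (D + ‖x‖ ^ 2) ^ α) →
          Integrable (fun x => f x * (D + ‖x‖ ^ 2) ^ (α - 1)) →
          (∫ x, f x * (D + ‖x‖ ^ 2) ^ (α - 1)) = 0 →
          Λ * ∫ x, |f x| ^ 2 * (D + ‖x‖ ^ 2) ^ (α - 1)
            ≤ ∫ x, ‖gradient f x‖ ^ 2 * (D + ‖x‖ ^ 2) ^ α := by
  have hgrad : ∀ (f : EuclideanSpace ℝ (Fin d) → ℝ) x, ‖gradient f x‖ = ‖fderiv ℝ f x‖ := by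
    intro f x
    simp [gradient]
  simp only [hgrad, sq_abs]
  have hκ : (d : ℝ) - 2 + 2 * α ≠ 0 := by
    intro h
    by_cases h3 : 3 ≤ d
    · exact hne h3 (by linarith)
    · have : (d : ℝ) ≤ 2 := by exact_mod_cast (by omega : d ≤ 2)
      linarith
  rcases lt_or_gt_of_ne hκ with hlt | hgt
  · set k := -((d : ℝ) - 2 + 2 * α) with hk
    have hk0 : 0 < k := by linarith
    set σ := 8 * (1 - α) / k with hσ
    have hα1 : 0 < 1 - α := by linarith
    have hσ0 : 0 < σ := by positivity
    set M := 4 / k + 2 * (1 - α) * (4 * σ * 2 ^ d) * (1 + σ) ^ (-α) with hM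
    have hM0 : 0 < M := by positivity
    refine ⟨(k / 2) / M, by positivity, ?_⟩
    intro D hD f hf hA hB hI hz
    have := hp_neg α D hα hD k hk hk0 f hf hA hB hI hz σ hσ
    rw [div_mul_eq_mul_div, div_le_iff₀ hM0, mul_comm _ M]
    exact this
  · exact ⟨((d : ℝ) - 2 + 2 * α) ^ 2 / 4, by positivity,
      fun D hD f hf hA hB _ _ => hp_pos α D hα hD hgt f hf hA hB⟩

end
end

section
/- Let d ≥ 1, d/2 < γ < (d+4)/2, M(v) = (1+|v|²)^{-γ/2}, ⟨v⟩ = (1+|v|²)^{1/2}. There is a constant C_{γ,d} > 0 such that for every g ∈ H¹_loc(ℝ^d) with ∫ |∇_v(g/M)|² M² dv < ∞ and ∫_{ℝ^d} g M ⟨v⟩^{-2} dv = 0, one has ∫_{ℝ^d} |g|² ⟨v⟩^{-2} dv ≤ C_{γ,d} ∫_{ℝ^d} |∇_v(g/M)|² M² dv. -/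
open MeasureTheory Real

noncomputable section

/-- Partial derivative of `f` in the `i`-th coordinate direction. -/
def pDeriv {d : ℕ} {G : Type*} [NormedAddCommGroup G] [NormedSpace ℝ G]
    (f : EuclideanSpace ℝ (Fin d) → G) (i : Fin d) (v : EuclideanSpace ℝ (Fin d)) : G :=
  fderiv ℝ f v (EuclideanSpace.single i 1)

lemma aux_half (d : ℕ) (γ : ℝ) (h1 : (d : ℝ) / 2 < γ) (s A B : ℝ) (hs : 0 < s) (hs1 : s < 1)
    (hA : 1 ≤ A) (hB : 1 ≤ B) (h : B ≤ 4 * (s ^ 2 * A)) :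
    A ^ (-γ) ≤ 4 ^ γ * B ^ (-γ) * s ^ d := by
  have hγ : 0 < γ := lt_of_le_of_lt (by positivity) h1
  have hA0 : 0 < A := by linarith
  have hB0 : 0 < B := by linarith
  have e1 : B ^ γ ≤ 4 ^ γ * (s ^ d * A ^ γ) := by
    calc B ^ γ ≤ (4 * (s ^ 2 * A)) ^ γ := Real.rpow_le_rpow hB0.le h hγ.le
      _ = 4 ^ γ * ((s ^ 2) ^ γ * A ^ γ) := by
        rw [Real.mul_rpow (by norm_num) (by positivity), Real.mul_rpow (by positivity) hA0.le]
      _ ≤ _ := by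
        have : (s ^ 2) ^ γ ≤ s ^ d := by
          rw [← Real.rpow_natCast s 2, ← Real.rpow_mul hs.le, ← Real.rpow_natCast s d]
          apply Real.rpow_le_rpow_of_exponent_ge hs hs1.le
          push_cast; linarith
        gcongr
  rw [Real.rpow_neg hA0.le, Real.rpow_neg hB0.le]
  have := Real.rpow_pos_of_pos hA0 γ
  have := Real.rpow_pos_of_pos hB0 γ
  rw [inv_eq_one_div, div_le_iff₀ (by assumption)]
  have : 4 ^ γ * (B ^ γ)⁻¹ * s ^ d * A ^ γ = (4 ^ γ * (s ^ d * A ^ γ)) / B ^ γ := by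
    field_simp
  rw [this, le_div_iff₀ (by assumption)]
  linarith

lemma aux_pt (d : ℕ) (γ : ℝ) (h1 : (d : ℝ) / 2 < γ) (x y : EuclideanSpace ℝ (Fin d))
    (t : ℝ) (ht0 : 0 < t) (ht1 : t < 1) :
    (1 + ‖x‖ ^ 2) ^ (-γ) / (1 + ‖x‖ ^ 2) * ((1 + ‖y‖ ^ 2) ^ (-γ) / (1 + ‖y‖ ^ 2)) * ‖x - y‖ ^ 2 ≤
      4 * 4 ^ γ * (1 + ‖(1 - t) • y + t • x‖ ^ 2) ^ (-γ) *
        (t ^ d * (1 + ‖y‖ ^ 2) ^ (-γ) + (1 - t) ^ d * (1 + ‖x‖ ^ 2) ^ (-γ)) := by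
  set z := (1 - t) • y + t • x
  have hz : ‖z‖ ≤ (1 - t) * ‖y‖ + t * ‖x‖ := by
    refine (norm_add_le _ _).trans ?_
    rw [norm_smul, norm_smul, Real.norm_of_nonneg ht0.le, Real.norm_of_nonneg (by linarith)]
  have hxy : ‖x - y‖ ≤ ‖x‖ + ‖y‖ := norm_sub_le _ _
  have nx := norm_nonneg x
  have ny := norm_nonneg y
  have nz := norm_nonneg z
  have nxy := norm_nonneg (x - y)
  have hz2 : ‖z‖ ^ 2 ≤ ((1 - t) * ‖y‖ + t * ‖x‖) ^ 2 := by gcongr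
  have hxy2 : ‖x - y‖ ^ 2 ≤ (‖x‖ + ‖y‖) ^ 2 := by gcongr
  have hX : 1 ≤ 1 + ‖x‖ ^ 2 := by nlinarith
  have hY : 1 ≤ 1 + ‖y‖ ^ 2 := by nlinarith
  have hZ : 1 ≤ 1 + ‖z‖ ^ 2 := by nlinarith
  have hZle : 1 + ‖z‖ ^ 2 ≤ 2 * ((1 - t) ^ 2 * (1 + ‖y‖ ^ 2)) + 2 * (t ^ 2 * (1 + ‖x‖ ^ 2)) := by
    nlinarith [sq_nonneg ((1 - t) * ‖y‖ - t * ‖x‖), sq_nonneg (1 - 2 * t)]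
  have hD : ‖x - y‖ ^ 2 ≤ 4 * ((1 + ‖x‖ ^ 2) * (1 + ‖y‖ ^ 2)) := by
    nlinarith [sq_nonneg (‖x‖ - ‖y‖), mul_nonneg (sq_nonneg ‖x‖) (sq_nonneg ‖y‖)]
  generalize 1 + ‖x‖ ^ 2 = X at *
  generalize 1 + ‖y‖ ^ 2 = Y at *
  generalize 1 + ‖z‖ ^ 2 = Z at *
  have pX : 0 < X ^ (-γ) := Real.rpow_pos_of_pos (by linarith) _
  have pY : 0 < Y ^ (-γ) := Real.rpow_pos_of_pos (by linarith) _
  have pZ : 0 < Z ^ (-γ) := Real.rpow_pos_of_pos (by linarith) _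
  have p4 : (0 : ℝ) < 4 ^ γ := Real.rpow_pos_of_pos (by norm_num) _
  have ht1' : 0 < 1 - t := by linarith
  have X0 : 0 < X := by linarith
  have Y0 : 0 < Y := by linarith
  have step1 : X ^ (-γ) / X * (Y ^ (-γ) / Y) * ‖x - y‖ ^ 2 ≤ 4 * (X ^ (-γ) * Y ^ (-γ)) := by
    have : X ^ (-γ) / X * (Y ^ (-γ) / Y) * ‖x - y‖ ^ 2
      = (X ^ (-γ) * Y ^ (-γ)) * (‖x - y‖ ^ 2 / (X * Y)) := by field_simp
    rw [this]
    have : ‖x - y‖ ^ 2 / (X * Y) ≤ 4 := by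
      rw [div_le_iff₀ (by positivity)]; exact hD
    nlinarith [mul_pos pX pY]
  have step2 : X ^ (-γ) * Y ^ (-γ) ≤
      4 ^ γ * Z ^ (-γ) * (t ^ d * Y ^ (-γ) + (1 - t) ^ d * X ^ (-γ)) := by
    rcases le_total ((1 - t) ^ 2 * Y) (t ^ 2 * X) with h | h
    · have := aux_half d γ h1 t X Z ht0 ht1 hX hZ (by linarith)
      calc _ ≤ (4 ^ γ * Z ^ (-γ) * t ^ d) * Y ^ (-γ) := by gcongr
        _ = 4 ^ γ * Z ^ (-γ) * (t ^ d * Y ^ (-γ) + 0) := by ring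
        _ ≤ _ := by gcongr; positivity
    · have := aux_half d γ h1 (1 - t) Y Z ht1' (by linarith) hY hZ (by linarith)
      calc _ ≤ X ^ (-γ) * (4 ^ γ * Z ^ (-γ) * (1 - t) ^ d) := by gcongr
        _ = 4 ^ γ * Z ^ (-γ) * (0 + (1 - t) ^ d * X ^ (-γ)) := by ring
        _ ≤ _ := by gcongr; positivity
  calc _ ≤ _ := step1
    _ ≤ 4 * (4 ^ γ * Z ^ (-γ) * (t ^ d * Y ^ (-γ) + (1 - t) ^ d * X ^ (-γ))) := by gcongr
    _ = _ := by ring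

lemma aux_cs {d : ℕ} (f : EuclideanSpace ℝ (Fin d) → ℝ) (z h : EuclideanSpace ℝ (Fin d)) :
    (fderiv ℝ f z h) ^ 2 ≤ (∑ i, (pDeriv f i z) ^ 2) * ‖h‖ ^ 2 := by
  have : fderiv ℝ f z h = ∑ i, pDeriv f i z * h i := by
    have hh : h = ∑ i, h i • EuclideanSpace.single i (1 : ℝ) := by
      ext j; simp [Finset.sum_apply, Pi.single_apply]
    conv_lhs => rw [hh]
    rw [map_sum]
    refine Finset.sum_congr rfl fun i _ => ?_
    rw [map_smul, smul_eq_mul, mul_comm]; rfl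
  rw [this, EuclideanSpace.real_norm_sq_eq]
  exact Finset.sum_mul_sq_le_sq_mul_sq _ _ _

lemma aux_sq (φ : ℝ → ℝ) (hφ : Differentiable ℝ φ) :
    ENNReal.ofReal ((φ 1 - φ 0) ^ 2) ≤
      ∫⁻ t in Set.Ioo (0 : ℝ) 1, ENNReal.ofReal ((deriv φ t) ^ 2) := by
  have hm : Measurable (deriv φ) := measurable_deriv φ
  by_cases hfin : ∫⁻ t in Set.Ioo (0 : ℝ) 1, ENNReal.ofReal ((deriv φ t) ^ 2) = ⊤
  · rw [hfin]; exact le_top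
  have h2 : Integrable (fun t => (deriv φ t) ^ 2) (volume.restrict (Set.Ioo (0 : ℝ) 1)) := by
    refine ⟨(hm.pow_const 2).aestronglyMeasurable, ?_⟩
    rw [hasFiniteIntegral_iff_ofReal (Filter.Eventually.of_forall fun t => sq_nonneg _)]
    exact lt_top_iff_ne_top.2 hfin
  have h1 : Integrable (deriv φ) (volume.restrict (Set.Ioo (0 : ℝ) 1)) := by
    have : MemLp (deriv φ) 2 (volume.restrict (Set.Ioo (0 : ℝ) 1)) :=
      (memLp_two_iff_integrable_sq hm.aestronglyMeasurable).2 h2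
    exact this.integrable (by norm_num)
  rw [← ofReal_integral_eq_lintegral_ofReal h2 (Filter.Eventually.of_forall fun t => sq_nonneg _)]
  apply ENNReal.ofReal_le_ofReal
  have ftc : ∫ t in Set.Ioo (0 : ℝ) 1, deriv φ t = φ 1 - φ 0 := by
    rw [← integral_Ioc_eq_integral_Ioo, ← intervalIntegral.integral_of_le zero_le_one]
    apply intervalIntegral.integral_eq_sub_of_hasDerivAt (fun t _ => (hφ t).hasDerivAt)
    rw [intervalIntegrable_iff_integrableOn_Ioo_of_le zero_le_one]
    exact h1
  set A := φ 1 - φ 0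
  have hc : Integrable (fun _ : ℝ => A ^ 2) (volume.restrict (Set.Ioo (0 : ℝ) 1)) :=
    integrable_const _
  have key : 0 ≤ ∫ t in Set.Ioo (0 : ℝ) 1, (deriv φ t ^ 2 - 2 * A * deriv φ t + A ^ 2) :=
    integral_nonneg fun t => by
      show 0 ≤ deriv φ t ^ 2 - 2 * A * deriv φ t + A ^ 2
      nlinarith [sq_nonneg (deriv φ t - A)]
  have hs : Integrable (fun t => deriv φ t ^ 2 - 2 * A * deriv φ t)
      (volume.restrict (Set.Ioo (0 : ℝ) 1)) := h2.sub (h1.const_mul _)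
  rw [integral_add hs hc, integral_sub h2 (h1.const_mul _),
    integral_const_mul, ftc] at key
  simp at key
  linarith

lemma aux_line {d : ℕ} (f : EuclideanSpace ℝ (Fin d) → ℝ) (hf : Differentiable ℝ f)
    (x y : EuclideanSpace ℝ (Fin d)) :
    ENNReal.ofReal ((f x - f y) ^ 2) ≤
      ∫⁻ t in Set.Ioo (0 : ℝ) 1,
        ENNReal.ofReal ((∑ i, (pDeriv f i ((1 - t) • y + t • x)) ^ 2) * ‖x - y‖ ^ 2) := by
  have hd : ∀ t, HasDerivAt (fun t : ℝ => f ((1 - t) • y + t • x))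
      (fderiv ℝ f ((1 - t) • y + t • x) (x - y)) t := by
    intro t
    have : HasDerivAt (fun t : ℝ => (1 - t) • y + t • x) (x - y) t := by
      have := (((hasDerivAt_id t).const_sub 1).smul_const y).add ((hasDerivAt_id t).smul_const x)
      have e : (-1 : ℝ) • y + (1 : ℝ) • x = x - y := by
        rw [neg_one_smul, one_smul, sub_eq_neg_add]
      rw [e] at this
      exact this
    exact (hf _).hasFDerivAt.comp_hasDerivAt t this
  have := aux_sq _ (fun t => (hd t).differentiableAt)
  simp only [sub_self, zero_smul, one_smul, zero_add, sub_zero, add_zero] at this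
  refine this.trans (lintegral_mono fun t => ?_)
  apply ENNReal.ofReal_le_ofReal
  rw [(hd t).deriv]
  exact aux_cs f _ _

lemma aux_cov {d : ℕ} (H : EuclideanSpace ℝ (Fin d) → ENNReal) (hH : Measurable H)
    (a : EuclideanSpace ℝ (Fin d)) (t : ℝ) (ht : 0 < t) :
    ENNReal.ofReal (t ^ d) * ∫⁻ x, H (a + t • x) = ∫⁻ x, H x := by
  have e1 : ∫⁻ x, H (a + t • x) = ∫⁻ x, H (a + x) ∂(Measure.map (t • ·) volume) := by
    rw [lintegral_map (by fun_prop) (by fun_prop)]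
  rw [e1, Measure.map_addHaar_smul _ ht.ne', lintegral_smul_measure, lintegral_add_left_eq_self,
    smul_eq_mul, ← mul_assoc, ← ENNReal.ofReal_mul (by positivity)]
  rw [finrank_euclideanSpace_fin, abs_of_pos (by positivity), mul_inv_cancel₀ (by positivity)]
  simp

set_option maxHeartbeats 1000000 in
lemma aux_main {d : ℕ} (γ : ℝ) (h1 : (d : ℝ) / 2 < γ)
    (f : EuclideanSpace ℝ (Fin d) → ℝ) (hf : Differentiable ℝ f) :
    ∫⁻ x : EuclideanSpace ℝ (Fin d), ∫⁻ y : EuclideanSpace ℝ (Fin d),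
      ENNReal.ofReal ((1 + ‖x‖ ^ 2) ^ (-γ) / (1 + ‖x‖ ^ 2) *
        ((1 + ‖y‖ ^ 2) ^ (-γ) / (1 + ‖y‖ ^ 2)) * (f x - f y) ^ 2) ≤
    ENNReal.ofReal (4 * 4 ^ γ) *
      (2 * ((∫⁻ x : EuclideanSpace ℝ (Fin d), ENNReal.ofReal ((1 + ‖x‖ ^ 2) ^ (-γ))) *
        ∫⁻ z, ENNReal.ofReal ((∑ i, (pDeriv f i z) ^ 2) * (1 + ‖z‖ ^ 2) ^ (-γ)))) := by
  set p : EuclideanSpace ℝ (Fin d) → ℝ := fun x => (1 + ‖x‖ ^ 2) ^ (-γ) with hp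
  set w : EuclideanSpace ℝ (Fin d) → ℝ := fun x => p x / (1 + ‖x‖ ^ 2) with hw
  set G : EuclideanSpace ℝ (Fin d) → ℝ := fun z => ∑ i, (pDeriv f i z) ^ 2 with hG
  set H : EuclideanSpace ℝ (Fin d) → ENNReal := fun z => ENNReal.ofReal (G z * p z) with hH
  have mp : Measurable p := by
    have : Measurable fun x : EuclideanSpace ℝ (Fin d) => 1 + ‖x‖ ^ 2 := by fun_prop
    exact this.pow_const _
  have mG : Measurable G := Finset.measurable_sum _ fun i _ =>
    (measurable_fderiv_apply_const ℝ f _).pow_const 2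
  have mH : Measurable H := (mG.mul mp).ennreal_ofReal
  have p0 : ∀ x, 0 ≤ p x := fun x => by positivity
  have w0 : ∀ x, 0 ≤ w x := fun x => by positivity
  have G0 : ∀ x, 0 ≤ G x := fun x => Finset.sum_nonneg fun i _ => sq_nonneg _
  let P : EuclideanSpace ℝ (Fin d) → ENNReal := fun x => ENNReal.ofReal (p x)
  have mP : Measurable P := mp.ennreal_ofReal
  let Φ : ℝ → EuclideanSpace ℝ (Fin d) → EuclideanSpace ℝ (Fin d) → ENNReal := fun t x y =>
    ENNReal.ofReal (t ^ d) * P y * H ((1 - t) • y + t • x) +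
      ENNReal.ofReal ((1 - t) ^ d) * P x * H ((1 - t) • y + t • x)
  have mΦ : Measurable fun q : ℝ × EuclideanSpace ℝ (Fin d) × EuclideanSpace ℝ (Fin d) =>
      Φ q.1 q.2.1 q.2.2 := by fun_prop
  have bound : ∀ x y, ENNReal.ofReal (w x * w y * (f x - f y) ^ 2) ≤
      ∫⁻ t in Set.Ioo (0 : ℝ) 1, ENNReal.ofReal (4 * 4 ^ γ) * Φ t x y := by
    intro x y
    rw [ENNReal.ofReal_mul (mul_nonneg (w0 x) (w0 y))]
    calc _ ≤ ENNReal.ofReal (w x * w y) * ∫⁻ t in Set.Ioo (0 : ℝ) 1,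
          ENNReal.ofReal (G ((1 - t) • y + t • x) * ‖x - y‖ ^ 2) := by
          gcongr; exact aux_line f hf x y
      _ = ∫⁻ t in Set.Ioo (0 : ℝ) 1, ENNReal.ofReal (w x * w y) *
          ENNReal.ofReal (G ((1 - t) • y + t • x) * ‖x - y‖ ^ 2) := by
          rw [lintegral_const_mul]
          fun_prop
      _ ≤ _ := by
          refine setLIntegral_mono' measurableSet_Ioo fun t ht => ?_
          have hpt := aux_pt d γ h1 x y t ht.1 ht.2
          have ht0 : 0 < t := ht.1
          have ht1 : 0 < 1 - t := by linarith [ht.2]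
          have e : ENNReal.ofReal (4 * 4 ^ γ) * Φ t x y = ENNReal.ofReal
              (4 * 4 ^ γ * (t ^ d * p y * (G ((1 - t) • y + t • x) * p ((1 - t) • y + t • x)) +
                (1 - t) ^ d * p x * (G ((1 - t) • y + t • x) * p ((1 - t) • y + t • x)))) := by
            have hGp := mul_nonneg (G0 ((1 - t) • y + t • x)) (p0 ((1 - t) • y + t • x))
            have a1 := mul_nonneg (pow_nonneg ht0.le d) (p0 y)
            have a2 := mul_nonneg (pow_nonneg ht1.le d) (p0 x)
            rw [ENNReal.ofReal_mul (p := 4 * 4 ^ γ) (by positivity),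
              ENNReal.ofReal_add (mul_nonneg a1 hGp) (mul_nonneg a2 hGp),
              ENNReal.ofReal_mul a1, ENNReal.ofReal_mul a2,
              ENNReal.ofReal_mul (pow_nonneg ht0.le d), ENNReal.ofReal_mul (pow_nonneg ht1.le d)]
          rw [e, ← ENNReal.ofReal_mul (mul_nonneg (w0 x) (w0 y))]
          apply ENNReal.ofReal_le_ofReal
          have := mul_le_mul_of_nonneg_left hpt (G0 ((1 - t) • y + t • x))
          calc _ = G ((1 - t) • y + t • x) * (w x * w y * ‖x - y‖ ^ 2) := by ring
            _ ≤ _ := this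
            _ = _ := by simp only [hp]; ring
  calc _ ≤ ∫⁻ x, ∫⁻ y, ∫⁻ t in Set.Ioo (0 : ℝ) 1, ENNReal.ofReal (4 * 4 ^ γ) * Φ t x y :=
        lintegral_mono fun x => lintegral_mono fun y => bound x y
    _ = ∫⁻ x, ∫⁻ t in Set.Ioo (0 : ℝ) 1, ∫⁻ y, ENNReal.ofReal (4 * 4 ^ γ) * Φ t x y := by
        congr 1; funext x
        apply lintegral_lintegral_swap
        apply Measurable.aemeasurable
        exact (mΦ.comp (by fun_prop : Measurable fun q : EuclideanSpace ℝ (Fin d) × ℝ =>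
          (q.2, x, q.1))).const_mul _
    _ = ∫⁻ t in Set.Ioo (0 : ℝ) 1, ∫⁻ x, ∫⁻ y, ENNReal.ofReal (4 * 4 ^ γ) * Φ t x y := by
        apply lintegral_lintegral_swap
        apply Measurable.aemeasurable
        apply Measurable.lintegral_prod_right'
          (f := fun q : (EuclideanSpace ℝ (Fin d) × ℝ) × EuclideanSpace ℝ (Fin d) =>
            ENNReal.ofReal (4 * 4 ^ γ) * Φ q.1.2 q.1.1 q.2)
        exact (mΦ.comp (by fun_prop :
          Measurable fun q : (EuclideanSpace ℝ (Fin d) × ℝ) × EuclideanSpace ℝ (Fin d) =>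
          (q.1.2, q.1.1, q.2))).const_mul _
    _ ≤ ∫⁻ t in Set.Ioo (0 : ℝ) 1, ENNReal.ofReal (4 * 4 ^ γ) *
          (2 * ((∫⁻ x, P x) * ∫⁻ z, H z)) := by
        refine setLIntegral_mono' measurableSet_Ioo fun t ht => ?_
        have ht0 : 0 < t := ht.1
        have ht1 : 0 < 1 - t := by linarith [ht.2]
        have c1 : ∫⁻ x, ∫⁻ y, ENNReal.ofReal (4 * 4 ^ γ) * Φ t x y =
            ENNReal.ofReal (4 * 4 ^ γ) * ∫⁻ x, ∫⁻ y, Φ t x y := by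
          rw [← lintegral_const_mul' _ _ ENNReal.ofReal_ne_top]
          congr 1; funext x
          rw [lintegral_const_mul' _ _ ENNReal.ofReal_ne_top]
        rw [c1]
        gcongr
        have c2 : ∫⁻ x, ∫⁻ y, ENNReal.ofReal (t ^ d) * P y * H ((1 - t) • y + t • x) =
            (∫⁻ x, P x) * ∫⁻ z, H z := by
          rw [lintegral_lintegral_swap (by fun_prop), ← lintegral_mul_const _ mP]
          congr 1; funext y
          rw [lintegral_const_mul _ (by fun_prop), ← aux_cov H mH ((1 - t) • y) t ht0]
          ring
        have c3 : ∫⁻ x, ∫⁻ y, ENNReal.ofReal ((1 - t) ^ d) * P x * H ((1 - t) • y + t • x) =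
            (∫⁻ x, P x) * ∫⁻ z, H z := by
          rw [← lintegral_mul_const _ mP]
          congr 1; funext x
          rw [lintegral_const_mul _ (by fun_prop), ← aux_cov H mH (t • x) (1 - t) ht1]
          simp only [add_comm (t • x)]
          ring
        have c4 : ∫⁻ x, ∫⁻ y, Φ t x y = (∫⁻ x, P x) * (∫⁻ z, H z) + (∫⁻ x, P x) * ∫⁻ z, H z := by
          rw [← c2]
          nth_rw 2 [c2]
          rw [← c3]
          rw [← lintegral_add_left (by
            apply Measurable.lintegral_prod_right'
              (f := fun q : EuclideanSpace ℝ (Fin d) × EuclideanSpace ℝ (Fin d) =>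
              ENNReal.ofReal (t ^ d) * P q.2 * H ((1 - t) • q.2 + t • q.1))
            fun_prop)]
          congr 1; funext x
          rw [← lintegral_add_left (by fun_prop)]
        rw [c4, two_mul]
    _ = _ := by
        rw [lintegral_const]
        rw [Measure.restrict_apply_univ, Real.volume_Ioo, sub_zero, ENNReal.ofReal_one, mul_one]

theorem stmt5 (d : ℕ) (hd : 1 ≤ d) (γ : ℝ)
    (h1 : (d : ℝ) / 2 < γ) (h2 : γ < ((d : ℝ) + 4) / 2)
    (M : EuclideanSpace ℝ (Fin d) → ℝ)
    (hM : ∀ v, M v = (1 + ‖v‖ ^ 2) ^ (-(γ / 2))) :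
    ∃ C : ℝ, 0 < C ∧
      ∀ g : EuclideanSpace ℝ (Fin d) → ℝ, Differentiable ℝ g →
        Integrable (fun v => (∑ i, (pDeriv (fun w => g w / M w) i v) ^ 2) * (M v) ^ 2) →
        Integrable (fun v => g v ^ 2 / (1 + ‖v‖ ^ 2)) →
        Integrable (fun v => g v * M v / (1 + ‖v‖ ^ 2)) →
        (∫ v, g v * M v / (1 + ‖v‖ ^ 2)) = 0 →
        ∫ v, g v ^ 2 / (1 + ‖v‖ ^ 2)
          ≤ C * ∫ v, (∑ i, (pDeriv (fun w => g w / M w) i v) ^ 2) * (M v) ^ 2 := by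
  have a0 : ∀ v : EuclideanSpace ℝ (Fin d), 0 < 1 + ‖v‖ ^ 2 := fun v => by positivity
  have M0 : ∀ v, 0 < M v := fun v => by rw [hM]; exact Real.rpow_pos_of_pos (a0 v) _
  have M2 : ∀ v, M v ^ 2 = (1 + ‖v‖ ^ 2) ^ (-γ) := fun v => by
    rw [hM, ← Real.rpow_natCast, ← Real.rpow_mul (a0 v).le]; congr 1; push_cast; ring
  have hMd : Differentiable ℝ M := by
    have : M = fun v => (1 + ‖v‖ ^ 2) ^ (-(γ / 2)) := funext hM
    rw [this]
    intro v
    apply DifferentiableAt.rpow_const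
    · exact ((differentiable_id.norm_sq ℝ).const_add 1) v
    · exact Or.inl (a0 v).ne'
  have ip : Integrable (fun v : EuclideanSpace ℝ (Fin d) => (1 + ‖v‖ ^ 2) ^ (-γ)) := by
    have := integrable_rpow_neg_one_add_norm_sq (E := EuclideanSpace ℝ (Fin d)) (μ := volume)
      (r := 2 * γ) (by rw [finrank_euclideanSpace_fin]; linarith)
    convert this using 3
    ring
  have iw : Integrable (fun v : EuclideanSpace ℝ (Fin d) =>
      (1 + ‖v‖ ^ 2) ^ (-γ) / (1 + ‖v‖ ^ 2)) := by
    refine ip.mono' ?_ (Filter.Eventually.of_forall fun v => ?_)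
    · exact (ip.aestronglyMeasurable.aemeasurable.div (by fun_prop)).aestronglyMeasurable
    · have := Real.rpow_pos_of_pos (a0 v) (-γ)
      rw [Real.norm_of_nonneg (div_nonneg this.le (a0 v).le)]
      apply div_le_self this.le
      nlinarith [sq_nonneg ‖v‖]
  have pos : ∀ u : EuclideanSpace ℝ (Fin d) → ℝ, Integrable u → (∀ v, 0 < u v) → 0 < ∫ v, u v := by
    intro u hu h0
    rw [integral_pos_iff_support_of_nonneg (fun v => (h0 v).le) hu]
    have : Function.support u = Set.univ := Set.eq_univ_of_forall fun v => (h0 v).ne'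
    rw [this]
    exact Measure.measure_univ_pos.2 (NeZero.ne _)
  have P0 := pos _ ip fun v => Real.rpow_pos_of_pos (a0 v) _
  have w0 : ∀ v : EuclideanSpace ℝ (Fin d), 0 < (1 + ‖v‖ ^ 2) ^ (-γ) / (1 + ‖v‖ ^ 2) :=
    fun v => div_pos (Real.rpow_pos_of_pos (a0 v) _) (a0 v)
  have W0 := pos _ iw w0
  set Pc := ∫ v : EuclideanSpace ℝ (Fin d), (1 + ‖v‖ ^ 2) ^ (-γ) with hPc
  set Wc := ∫ v : EuclideanSpace ℝ (Fin d), (1 + ‖v‖ ^ 2) ^ (-γ) / (1 + ‖v‖ ^ 2) with hWc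
  refine ⟨4 * 4 ^ γ * (2 * Pc) / Wc, by positivity, ?_⟩
  intro g hg iH ig2 igM hmean
  have hfd : Differentiable ℝ (fun v => g v / M v) := fun v => by
    simp only [div_eq_mul_inv]
    exact (hg v).mul ((hMd v).inv (M0 v).ne')
  have main := aux_main γ h1 _ hfd
  simp only [M2] at iH ⊢
  set f := fun v => g v / M v with hf
  have hH0 : ∀ z, 0 ≤ (∑ i, (pDeriv f i z) ^ 2) * (1 + ‖z‖ ^ 2) ^ (-γ) := fun z =>
    mul_nonneg (Finset.sum_nonneg fun i _ => sq_nonneg _) (Real.rpow_pos_of_pos (a0 z) _).le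
  set I := ∫ v, g v ^ 2 / (1 + ‖v‖ ^ 2) with hI
  set J := ∫ z, (∑ i, (pDeriv f i z) ^ 2) * (1 + ‖z‖ ^ 2) ^ (-γ) with hJ
  have J0 : 0 ≤ J := integral_nonneg hH0
  have I0 : 0 ≤ I := integral_nonneg fun v => div_nonneg (sq_nonneg _) (a0 v).le
  rw [← ofReal_integral_eq_lintegral_ofReal ip (Filter.Eventually.of_forall fun v =>
      (Real.rpow_pos_of_pos (a0 v) _).le),
    ← ofReal_integral_eq_lintegral_ofReal iH (Filter.Eventually.of_forall hH0),
    ← hPc, ← hJ] at main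
  have low : ∀ x : EuclideanSpace ℝ (Fin d),
      ENNReal.ofReal ((1 + ‖x‖ ^ 2) ^ (-γ) / (1 + ‖x‖ ^ 2)) * ENNReal.ofReal I ≤
      ∫⁻ y : EuclideanSpace ℝ (Fin d), ENNReal.ofReal ((1 + ‖x‖ ^ 2) ^ (-γ) / (1 + ‖x‖ ^ 2) *
        ((1 + ‖y‖ ^ 2) ^ (-γ) / (1 + ‖y‖ ^ 2)) * (f x - f y) ^ 2) := by
    intro x
    have e : ∀ y, (1 + ‖x‖ ^ 2) ^ (-γ) / (1 + ‖x‖ ^ 2) *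
        ((1 + ‖y‖ ^ 2) ^ (-γ) / (1 + ‖y‖ ^ 2)) * (f x - f y) ^ 2 =
        (1 + ‖x‖ ^ 2) ^ (-γ) / (1 + ‖x‖ ^ 2) * (g y ^ 2 / (1 + ‖y‖ ^ 2) -
          2 * f x * (g y * M y / (1 + ‖y‖ ^ 2)) +
          f x ^ 2 * ((1 + ‖y‖ ^ 2) ^ (-γ) / (1 + ‖y‖ ^ 2))) := by
      intro y
      have hgy : g y = f y * M y := by simp only [hf]; field_simp [(M0 y).ne']
      rw [hgy, ← M2 y]
      ring
    have i1 : Integrable (fun y => g y ^ 2 / (1 + ‖y‖ ^ 2) -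
          2 * f x * (g y * M y / (1 + ‖y‖ ^ 2))) := ig2.sub (igM.const_mul _)
    have i2 : Integrable (fun y => g y ^ 2 / (1 + ‖y‖ ^ 2) -
          2 * f x * (g y * M y / (1 + ‖y‖ ^ 2)) +
          f x ^ 2 * ((1 + ‖y‖ ^ 2) ^ (-γ) / (1 + ‖y‖ ^ 2))) := i1.add (iw.const_mul _)
    have i3 := i2.const_mul ((1 + ‖x‖ ^ 2) ^ (-γ) / (1 + ‖x‖ ^ 2))
    rw [← ENNReal.ofReal_mul (w0 x).le, ← ofReal_integral_eq_lintegral_ofReal]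
    · apply ENNReal.ofReal_le_ofReal
      simp_rw [e]
      rw [integral_const_mul, integral_add i1 (iw.const_mul _), integral_sub ig2 (igM.const_mul _),
        integral_const_mul, integral_const_mul, hmean]
      apply mul_le_mul_of_nonneg_left _ (w0 x).le
      rw [← hI, ← hWc]
      nlinarith [mul_nonneg (sq_nonneg (f x)) W0.le]
    · simp_rw [e]; exact i3
    · exact Filter.Eventually.of_forall fun y =>
        mul_nonneg (mul_nonneg (w0 x).le (w0 y).le) (sq_nonneg _)
  have tot := (lintegral_mono low).trans main
  rw [lintegral_mul_const' _ _ ENNReal.ofReal_ne_top,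
    ← ofReal_integral_eq_lintegral_ofReal iw (Filter.Eventually.of_forall fun v => (w0 v).le),
    ← hWc, ← ENNReal.ofReal_mul W0.le, ← ENNReal.ofReal_mul P0.le,
    show (2 : ENNReal) = ENNReal.ofReal 2 by simp, ← ENNReal.ofReal_mul (by norm_num),
    ← ENNReal.ofReal_mul (by positivity), ENNReal.ofReal_le_ofReal_iff (by positivity)] at tot
  rw [div_mul_eq_mul_div, le_div_iff₀ W0]
  linarith

end
end

section
/- (Weighted Poincaré inequality on a slab) Let d ≥ 2, γ > 0, R > 0, M(v) = (1+|v|²)^{-γ/2} on ℝ^d, and C_R = { v = (v₁,v') ∈ ℝ × ℝ^{d-1} : |v₁| ≤ R ≤ |v'| }. Then there exists a constant C > 0 (depending only on γ) such that for every ψ with ∫_{C_R} |∂_{v₁}(ψ/M)|² M² dv < ∞ and ψ(-R,·) = ψ(R,·) = 0, one has ‖ψ‖²_{L²(C_R)} ≤ C R² ∫_{C_R} |∂_{v₁}(ψ/M)|² M² dv. -/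
open MeasureTheory Real

noncomputable section

/-- The slab `C_R = { v = (v₁,v') : |v₁| ≤ R ≤ |v'| }`, where `v₁ = v 0` and
`|v'|² = |v|² - v₁²`. -/
def slab (d : ℕ) (h : 0 < d) (R : ℝ) : Set (EuclideanSpace ℝ (Fin d)) :=
  {v | |v ⟨0, h⟩| ≤ R ∧ R ^ 2 ≤ ‖v‖ ^ 2 - (v ⟨0, h⟩) ^ 2}

def lineMap {n : ℕ} (x : ℝ) (y : Fin n → ℝ) : EuclideanSpace ℝ (Fin (n + 1)) :=
  WithLp.toLp 2 (Fin.cons x y : Fin (n + 1) → ℝ)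

lemma lineMap_zero {n : ℕ} (x : ℝ) (y : Fin n → ℝ) : lineMap x y 0 = x := rfl

lemma lineMap_normsq {n : ℕ} (x : ℝ) (y : Fin n → ℝ) :
    ‖lineMap x y‖ ^ 2 = x ^ 2 + ∑ i, y i ^ 2 := by
  rw [EuclideanSpace.real_norm_sq_eq, Fin.sum_univ_succ]
  simp [lineMap]

lemma lineMap_eq {n : ℕ} (x : ℝ) (y : Fin n → ℝ) :
    lineMap x y = lineMap 0 y + x • EuclideanSpace.single (0 : Fin (n + 1)) (1 : ℝ) := by
  ext i
  refine Fin.cases ?_ (fun j => ?_) i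
  · simp [lineMap]
  · simp [lineMap]

lemma lineMap_hasDerivAt {n : ℕ} (x : ℝ) (y : Fin n → ℝ) :
    HasDerivAt (fun x => lineMap x y) (EuclideanSpace.single (0 : Fin (n + 1)) (1 : ℝ)) x := by
  have h : (fun x => lineMap x y) =
      fun x => lineMap 0 y + x • EuclideanSpace.single (0 : Fin (n + 1)) (1 : ℝ) := by
    funext x
    exact lineMap_eq x y
  rw [h]
  simpa using ((hasDerivAt_id x).smul_const
    (EuclideanSpace.single (0 : Fin (n + 1)) (1 : ℝ))).const_add (lineMap 0 y)

lemma lineMap_mp {n : ℕ} :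
    MeasurePreserving (fun p : ℝ × (Fin n → ℝ) => lineMap p.1 p.2) volume volume := by
  have h1 := (volume_preserving_piFinSuccAbove (fun _ : Fin (n + 1) => ℝ) 0).symm
  have h2 := (PiLp.volume_preserving_toLp (Fin (n + 1))).comp h1
  have e : (fun p : ℝ × (Fin n → ℝ) => lineMap p.1 p.2) =
      WithLp.toLp 2 ∘ (MeasurableEquiv.piFinSuccAbove (fun _ : Fin (n + 1) => ℝ) 0).symm := by
    funext p
    simp [lineMap, MeasurableEquiv.piFinSuccAbove_symm_apply, Fin.insertNthEquiv]
  rw [e]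
  exact h2

lemma lintegral_line {n : ℕ} (F : EuclideanSpace ℝ (Fin (n + 1)) → ENNReal) (hF : Measurable F) :
    ∫⁻ v, F v = ∫⁻ y : Fin n → ℝ, ∫⁻ x : ℝ, F (lineMap x y) := by
  rw [← (lineMap_mp (n := n)).lintegral_comp hF, Measure.volume_eq_prod]
  exact lintegral_prod_symm' _ (hF.comp lineMap_mp.measurable)

lemma slab_meas (n : ℕ) (R : ℝ) : MeasurableSet (slab (n + 1) (Nat.succ_pos n) R) := by
  apply IsClosed.measurableSet
  have h1 : IsClosed {v : EuclideanSpace ℝ (Fin (n + 1)) | |v 0| ≤ R} :=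
    isClosed_le (by fun_prop) (by fun_prop)
  have h2 : IsClosed {v : EuclideanSpace ℝ (Fin (n + 1)) | R ^ 2 ≤ ‖v‖ ^ 2 - (v 0) ^ 2} :=
    isClosed_le (by fun_prop) (by fun_prop)
  exact h1.inter h2

lemma slab_lintegral {n : ℕ} (R : ℝ) (F : EuclideanSpace ℝ (Fin (n + 1)) → ENNReal)
    (hF : Measurable F) :
    ∫⁻ v in slab (n + 1) (Nat.succ_pos n) R, F v =
      ∫⁻ y in {y : Fin n → ℝ | R ^ 2 ≤ ∑ i, y i ^ 2},
        ∫⁻ x in Set.Icc (-R) R, F (lineMap x y) := by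
  have hY : MeasurableSet {y : Fin n → ℝ | R ^ 2 ≤ ∑ i, y i ^ 2} :=
    (isClosed_le (by fun_prop) (by fun_prop)).measurableSet
  rw [← lintegral_indicator (slab_meas n R), lintegral_line _ (hF.indicator (slab_meas n R)),
    ← lintegral_indicator hY]
  congr 1
  funext y
  have key : ∀ x, lineMap x y ∈ slab (n + 1) (Nat.succ_pos n) R ↔
      x ∈ Set.Icc (-R) R ∧ R ^ 2 ≤ ∑ i, y i ^ 2 := by
    intro x
    change (|lineMap x y 0| ≤ R ∧ R ^ 2 ≤ ‖lineMap x y‖ ^ 2 - (lineMap x y 0) ^ 2) ↔ _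
    rw [lineMap_zero, lineMap_normsq, abs_le, add_sub_cancel_left]
    rfl
  by_cases hy : R ^ 2 ≤ ∑ i, y i ^ 2
  · rw [Set.indicator_of_mem (by exact hy), ← lintegral_indicator measurableSet_Icc]
    congr 1
    funext x
    by_cases hx : x ∈ Set.Icc (-R) R
    · rw [Set.indicator_of_mem hx, Set.indicator_of_mem ((key x).2 ⟨hx, hy⟩)]
    · rw [Set.indicator_of_notMem hx, Set.indicator_of_notMem (fun h => hx ((key x).1 h).1)]
  · rw [Set.indicator_of_notMem (by exact hy)]
    have : ∀ x, (slab (n + 1) (Nat.succ_pos n) R).indicator F (lineMap x y) = 0 := fun x =>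
      Set.indicator_of_notMem (fun h => hy ((key x).1 h).2) _
    simp [this]

lemma enorm_le_lint (R : ℝ) (f : ℝ → ℂ) (hf : Differentiable ℝ f) (h0 : f (-R) = 0)
    (x : ℝ) (hx : x ∈ Set.Icc (-R) R) :
    ‖f x‖ₑ ≤ ∫⁻ w in Set.Icc (-R) R, ‖deriv f w‖ₑ := by
  by_cases hfin : ∫⁻ w in Set.Icc (-R) R, ‖deriv f w‖ₑ = ⊤
  · rw [hfin]; exact le_top
  have hint : IntegrableOn (deriv f) (Set.Icc (-R) R) :=
    ⟨(measurable_deriv f).aestronglyMeasurable, lt_top_iff_ne_top.2 hfin⟩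
  have hsub : Set.Ioc (-R) x ⊆ Set.Icc (-R) R := fun w hw => ⟨hw.1.le, hw.2.trans hx.2⟩
  have hii : IntervalIntegrable (deriv f) volume (-R) x :=
    (intervalIntegrable_iff_integrableOn_Ioc_of_le hx.1).2 (hint.mono_set hsub)
  have h := intervalIntegral.integral_eq_sub_of_hasDerivAt
    (fun x _ => (hf x).hasDerivAt) hii
  rw [h0, sub_zero, intervalIntegral.integral_of_le hx.1] at h
  rw [← h]
  exact (enorm_integral_le_lintegral_enorm _).trans (lintegral_mono_set hsub)

lemma sq_lint_le (R : ℝ) (g : ℝ → ENNReal) (hg : Measurable g) :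
    (∫⁻ w in Set.Icc (-R) R, g w) ^ 2 ≤
      ENNReal.ofReal (2 * R) * ∫⁻ w in Set.Icc (-R) R, g w ^ 2 := by
  have h := ENNReal.lintegral_mul_le_Lp_mul_Lq (volume.restrict (Set.Icc (-R) R))
    Real.HolderConjugate.two_two (f := fun _ => 1) (g := g) aemeasurable_const hg.aemeasurable
  simp only [Pi.mul_apply, one_mul, ENNReal.rpow_two, one_pow, lintegral_const,
    Measure.restrict_apply_univ, Real.volume_Icc] at h
  have h2 := pow_le_pow_left₀ (zero_le) h 2
  have e : ∀ a : ENNReal, (a ^ (1 / 2 : ℝ)) ^ 2 = a := by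
    intro a
    rw [← ENNReal.rpow_two, ← ENNReal.rpow_mul]
    norm_num
  rw [mul_pow, e, e] at h2
  have e2 : R - -R = 2 * R := by ring
  rwa [e2] at h2

lemma one_dim (R K : ℝ) (hR : 0 < R) (hK : 0 ≤ K) (f : ℝ → ℂ) (hf : Differentiable ℝ f)
    (h0 : f (-R) = 0) (m : ℝ → ℝ)
    (hmK : ∀ x ∈ Set.Icc (-R) R, ∀ w ∈ Set.Icc (-R) R, m x ^ 2 ≤ K * m w ^ 2) :
    ∫⁻ x in Set.Icc (-R) R, ENNReal.ofReal (‖f x‖ ^ 2 * m x ^ 2) ≤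
      ENNReal.ofReal (4 * K * R ^ 2) *
        ∫⁻ w in Set.Icc (-R) R, ENNReal.ofReal (‖deriv f w‖ ^ 2 * m w ^ 2) := by
  set J := ∫⁻ w in Set.Icc (-R) R, ENNReal.ofReal (‖deriv f w‖ ^ 2 * m w ^ 2) with hJ
  have hpt : ∀ x ∈ Set.Icc (-R) R, ENNReal.ofReal (‖f x‖ ^ 2 * m x ^ 2) ≤
      ENNReal.ofReal (2 * R) * (ENNReal.ofReal K * J) := by
    intro x hx
    have h1 : ENNReal.ofReal (‖f x‖ ^ 2 * m x ^ 2) = ‖f x‖ₑ ^ 2 * ENNReal.ofReal (m x ^ 2) := by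
      rw [ENNReal.ofReal_mul (by positivity), ENNReal.ofReal_pow (norm_nonneg _), ofReal_norm]
    have hmeas : Measurable (fun w => ‖deriv f w‖ₑ) := (measurable_deriv f).enorm
    have h2 : ‖f x‖ₑ ^ 2 ≤ ENNReal.ofReal (2 * R) *
        ∫⁻ w in Set.Icc (-R) R, ‖deriv f w‖ₑ ^ 2 :=
      (pow_le_pow_left₀ zero_le (enorm_le_lint R f hf h0 x hx) 2).trans
        (sq_lint_le R _ hmeas)
    rw [h1]
    refine (mul_le_mul_left h2 _).trans ?_
    rw [mul_assoc]
    refine mul_le_mul_right ?_ _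
    rw [← lintegral_mul_const _ (hmeas.pow_const 2), hJ,
      ← lintegral_const_mul' _ _ ENNReal.ofReal_ne_top]
    refine setLIntegral_mono' measurableSet_Icc (fun w hw => ?_)
    rw [← ofReal_norm, ← ENNReal.ofReal_pow (norm_nonneg _),
      ← ENNReal.ofReal_mul (by positivity), ← ENNReal.ofReal_mul hK]
    refine ENNReal.ofReal_le_ofReal ?_
    have := mul_le_mul_of_nonneg_left (hmK x hx w hw) (sq_nonneg ‖deriv f w‖)
    linarith
  refine (setLIntegral_mono' measurableSet_Icc hpt).trans ?_
  rw [setLIntegral_const, Real.volume_Icc, ← mul_assoc, mul_right_comm,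
    ← ENNReal.ofReal_mul (by positivity), ← ENNReal.ofReal_mul (by positivity)]
  refine le_of_eq ?_
  congr 2
  ring

theorem stmt9 (d : ℕ) (hd : 2 ≤ d) (γ : ℝ) (hγ : 0 < γ)
    (M : EuclideanSpace ℝ (Fin d) → ℝ)
    (hM : ∀ v, M v = (1 + ‖v‖ ^ 2) ^ (-(γ / 2))) :
    ∃ C : ℝ, 0 < C ∧
      ∀ R : ℝ, 0 < R →
        ∀ ψ : EuclideanSpace ℝ (Fin d) → ℂ, Differentiable ℝ ψ →
          (∀ v : EuclideanSpace ℝ (Fin d),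
            (v ⟨0, by omega⟩ = R ∨ v ⟨0, by omega⟩ = -R) → ψ v = 0) →
          IntegrableOn
            (fun v => ‖pDeriv (fun w => ψ w / (M w : ℂ)) ⟨0, by omega⟩ v‖ ^ 2 * (M v) ^ 2)
            (slab d (by omega) R) →
          ∫ v in slab d (by omega) R, ‖ψ v‖ ^ 2
            ≤ C * R ^ 2 *
              ∫ v in slab d (by omega) R,
                ‖pDeriv (fun w => ψ w / (M w : ℂ)) ⟨0, by omega⟩ v‖ ^ 2 * (M v) ^ 2 := by
  obtain ⟨n, rfl⟩ : ∃ n, d = n + 1 := ⟨d - 1, by omega⟩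
  have hMpos : ∀ v, 0 < M v := fun v => by rw [hM]; positivity
  have hMd : Differentiable ℝ M := by
    have : M = fun v => (1 + ‖v‖ ^ 2) ^ (-(γ / 2)) := funext hM
    rw [this]
    intro v
    have h1 : DifferentiableAt ℝ (fun v : EuclideanSpace ℝ (Fin (n + 1)) => 1 + ‖v‖ ^ 2) v :=
      (differentiableAt_id.norm_sq ℝ).const_add 1
    exact h1.rpow_const (Or.inl (by positivity))
  refine ⟨4 * 2 ^ γ, by positivity, ?_⟩
  intro R hR ψ hψ hb hint
  set g : EuclideanSpace ℝ (Fin (n + 1)) → ℂ := fun w => ψ w / (M w : ℂ) with hg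
  have hgd : Differentiable ℝ g := by
    intro v
    have h1 : DifferentiableAt ℝ (fun v => (((M v)⁻¹ : ℝ) : ℂ)) v :=
      Complex.ofRealCLM.differentiableAt.comp v ((hMd v).fun_inv (hMpos v).ne')
    have h2 : g = fun v => ψ v * (((M v)⁻¹ : ℝ) : ℂ) := by
      funext v
      simp [hg, div_eq_mul_inv]
    rw [h2]
    exact (hψ v).fun_mul h1
  have hgM : ∀ v, ‖ψ v‖ ^ 2 = ‖g v‖ ^ 2 * M v ^ 2 := by
    intro v
    have := (hMpos v).ne'
    simp only [hg, norm_div, Complex.norm_real, Real.norm_eq_abs, div_pow, sq_abs]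
    field_simp
  have hmeasψ : Measurable (fun v => ‖ψ v‖ ^ 2) := (hψ.continuous.norm.pow 2).measurable
  have hmeasD : Measurable (fun v => ‖pDeriv g 0 v‖ ^ 2 * M v ^ 2) :=
    ((measurable_fderiv_apply_const ℝ g _).norm.pow_const 2).mul
      ((hMd.continuous.pow 2).measurable)
  have main : ∫⁻ v in slab (n + 1) (Nat.succ_pos n) R, ENNReal.ofReal (‖ψ v‖ ^ 2) ≤
      ENNReal.ofReal (4 * 2 ^ γ * R ^ 2) *
      ∫⁻ v in slab (n + 1) (Nat.succ_pos n) R,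
        ENNReal.ofReal (‖pDeriv g 0 v‖ ^ 2 * M v ^ 2) := by
    rw [slab_lintegral R _ hmeasψ.ennreal_ofReal, slab_lintegral R _ hmeasD.ennreal_ofReal,
      ← lintegral_const_mul' _ _ ENNReal.ofReal_ne_top]
    have hY : MeasurableSet {y : Fin n → ℝ | R ^ 2 ≤ ∑ i, y i ^ 2} :=
      (isClosed_le (by fun_prop) (by fun_prop)).measurableSet
    refine setLIntegral_mono' hY (fun y hy => ?_)
    have hder : ∀ x, HasDerivAt (fun x => g (lineMap x y)) (pDeriv g 0 (lineMap x y)) x :=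
      fun x => HasFDerivAt.comp_hasDerivAt (l := g) (f := fun x => lineMap x y) x
        (hgd (lineMap x y)).hasFDerivAt (lineMap_hasDerivAt x y)
    have h1 := one_dim R (2 ^ γ) hR (by positivity) (fun x => g (lineMap x y))
      (fun x => (hder x).differentiableAt)
      (by
        have : ψ (lineMap (-R) y) = 0 := hb _ (Or.inr rfl)
        simp [hg, this])
      (fun x => M (lineMap x y)) (by
        intro x hx w hw
        have hy' : R ^ 2 ≤ ∑ i, y i ^ 2 := hy
        simp only [hM, lineMap_normsq]
        have hw2 : w ^ 2 ≤ R ^ 2 := sq_le_sq' hw.1 hw.2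
        set S := ∑ i, y i ^ 2
        have hS : 0 ≤ S := le_trans (sq_nonneg R) hy'
        have e : ∀ t : ℝ, 0 < t → (t ^ (-(γ / 2))) ^ 2 = (t ^ γ)⁻¹ := by
          intro t ht
          rw [← Real.rpow_natCast, ← Real.rpow_mul ht.le, ← Real.rpow_neg ht.le]
          congr 1
          push_cast
          ring
        have hA : 0 < 1 + (x ^ 2 + S) := by positivity
        have hB : 0 < 1 + (w ^ 2 + S) := by positivity
        rw [e _ hA, e _ hB, ← div_eq_mul_inv, inv_eq_one_div,
          div_le_div_iff₀ (by positivity) (by positivity), one_mul,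
          ← Real.mul_rpow (by norm_num) hA.le]
        exact Real.rpow_le_rpow hB.le (by nlinarith [sq_nonneg x]) hγ.le)
    simp only [(hder _).deriv] at h1
    simp only [hgM]
    exact h1
  have hRint : ∫ v in slab (n + 1) (Nat.succ_pos n) R, ‖pDeriv g 0 v‖ ^ 2 * M v ^ 2 =
      (∫⁻ v in slab (n + 1) (Nat.succ_pos n) R,
        ENNReal.ofReal (‖pDeriv g 0 v‖ ^ 2 * M v ^ 2)).toReal :=
    integral_eq_lintegral_of_nonneg_ae (Filter.Eventually.of_forall fun v => by positivity)
      hmeasD.aestronglyMeasurable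
  have hLint : ∫ v in slab (n + 1) (Nat.succ_pos n) R, ‖ψ v‖ ^ 2 =
      (∫⁻ v in slab (n + 1) (Nat.succ_pos n) R, ENNReal.ofReal (‖ψ v‖ ^ 2)).toReal :=
    integral_eq_lintegral_of_nonneg_ae (Filter.Eventually.of_forall fun v => by positivity)
      hmeasψ.aestronglyMeasurable
  have hfin : ∫⁻ v in slab (n + 1) (Nat.succ_pos n) R,
        ENNReal.ofReal (‖pDeriv g 0 v‖ ^ 2 * M v ^ 2) ≠ ⊤ :=
    (Integrable.lintegral_lt_top hint).ne
  change ∫ v in slab (n + 1) (Nat.succ_pos n) R, ‖ψ v‖ ^ 2 ≤ 4 * 2 ^ γ * R ^ 2 *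
    ∫ v in slab (n + 1) (Nat.succ_pos n) R, ‖pDeriv g 0 v‖ ^ 2 * M v ^ 2
  rw [hRint, hLint]
  have h3 := ENNReal.toReal_mono (ENNReal.mul_ne_top ENNReal.ofReal_ne_top hfin) main
  rwa [ENNReal.toReal_mul, ENNReal.toReal_ofReal (by positivity)] at h3

end
end

section
/- Let d ≥ 1, β > d, F(v) = C_β² (1+|v|²)^{-β/2} normalized so that ∫ F dv = 1. The Nash-type inequality holds: there is C > 0 such that for every bounded h : ℝ^d → ℝ with ∫ h F dv = 0 and ∫ |∇_v h|² F dv < ∞, one has ∫_{ℝ^d} h² F dv ≤ C ( ∫_{ℝ^d} |∇_v h|² F dv )^{(β-d)/(β-d+2)} ( ‖h‖_∞² )^{2/(β-d+2)}. -/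
open MeasureTheory Real
noncomputable section

abbrev E (d:ℕ) := EuclideanSpace ℝ (Fin d)
variable {d : ℕ}

def wt (β : ℝ) (x : E d) : ℝ := (1 + ‖x‖ ^ 2) ^ (-(β / 2))

lemma wt_pos (β : ℝ) (x : E d) : 0 < wt β x := by unfold wt; positivity

lemma wt_cont (β : ℝ) : Continuous (wt (d := d) β) := by
  unfold wt
  refine Continuous.rpow_const (by fun_prop) (fun x => Or.inl (by positivity))

lemma line (h : E d → ℝ) (hh : Differentiable ℝ h) (x y : E d) :
    ‖h (x + y) - h y‖ₑ ^ 2 ≤ ‖x‖ₑ ^ 2 * ∫⁻ t in Set.Ioc (0:ℝ) 1, ‖fderiv ℝ h (y + t • x)‖ₑ ^ 2 := by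
  set φ' : ℝ → ℝ := fun t => fderiv ℝ h (y + t • x) x with hφ'
  have hm : Measurable φ' := by
    have := (measurable_fderiv ℝ h).comp (show Measurable (fun t : ℝ => y + t • x) by fun_prop)
    exact this.apply_continuousLinearMap x
  have hd : ∀ t : ℝ, HasDerivAt (fun t : ℝ => h (y + t • x)) (φ' t) t := by
    intro t
    have h1 : HasDerivAt (fun t : ℝ => y + t • x) x t := by
      simpa using ((hasDerivAt_id t).smul_const x).const_add y
    exact (hh (y + t • x)).hasFDerivAt.comp_hasDerivAt t h1
  have key : ‖h (x + y) - h y‖ₑ ^ 2 ≤ ∫⁻ t in Set.Ioc (0:ℝ) 1, ‖φ' t‖ₑ ^ 2 := by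
    by_cases hfin : ∫⁻ t in Set.Ioc (0:ℝ) 1, ‖φ' t‖ₑ ^ 2 = ⊤
    · rw [hfin]; exact le_top
    have hp : IsProbabilityMeasure (volume.restrict (Set.Ioc (0:ℝ) 1)) := ⟨by simp⟩
    have e2 : eLpNorm φ' 2 (volume.restrict (Set.Ioc (0:ℝ) 1)) ^ 2 = ∫⁻ t in Set.Ioc (0:ℝ) 1, ‖φ' t‖ₑ ^ 2 := by
      rw [eLpNorm_eq_lintegral_rpow_enorm_toReal (by norm_num) (by norm_num), ← ENNReal.rpow_natCast, ← ENNReal.rpow_mul]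
      simp
    have hmem : MemLp φ' 2 (volume.restrict (Set.Ioc (0:ℝ) 1)) := by
      refine ⟨hm.aestronglyMeasurable, ?_⟩
      rw [← e2] at hfin
      rw [lt_top_iff_ne_top]
      intro h; simp [h] at hfin
    have hint : IntegrableOn φ' (Set.Ioc 0 1) := hmem.integrable (by norm_num)
    have hftc := intervalIntegral.integral_eq_sub_of_hasDerivAt (a := 0) (b := 1) (fun t _ => hd t)
      ((intervalIntegrable_iff_integrableOn_Ioc_of_le zero_le_one).2 hint)
    simp only [one_smul, zero_smul, add_zero] at hftc
    rw [add_comm x y, ← hftc, intervalIntegral.integral_of_le zero_le_one, ← e2]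
    gcongr
    refine (enorm_integral_le_lintegral_enorm _).trans ?_
    rw [← eLpNorm_one_eq_lintegral_enorm]
    exact eLpNorm_le_eLpNorm_of_exponent_le (by norm_num) hm.aestronglyMeasurable
  refine key.trans ?_
  rw [← lintegral_const_mul' _ _ (by simp)]
  refine lintegral_mono fun t => ?_
  rw [← mul_pow, mul_comm]
  gcongr
  exact ContinuousLinearMap.le_opENorm _ _

lemma real_ineq (β : ℝ) (hβ : 0 < β) (x z : E d) (t : ℝ) (ht : 0 < t) (hz : ‖z - t • x‖ ≤ 1) :
    wt β x ≤ 6 ^ (β / 2) * wt β z * (wt β x + t ^ β) := by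
  have h1 : ‖z‖ ≤ 1 + t * ‖x‖ := by
    have := norm_add_le (z - t • x) (t • x)
    rw [sub_add_cancel, norm_smul, Real.norm_of_nonneg ht.le] at this
    linarith
  have h2 : 1 + ‖z‖ ^ 2 ≤ 3 * (1 + t ^ 2 * ‖x‖ ^ 2) := by
    nlinarith [norm_nonneg z, norm_nonneg x, sq_nonneg (1 - t * ‖x‖)]
  have hb : 0 ≤ β / 2 := by positivity
  set u := max ((1 + ‖x‖ ^ 2)⁻¹) (t ^ 2) with hu
  have h3 : (1 + ‖x‖ ^ 2)⁻¹ ≤ 6 * (1 + ‖z‖ ^ 2)⁻¹ * u := by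
    have a1 : (1 + ‖x‖ ^ 2) * (1 + ‖x‖ ^ 2)⁻¹ = 1 := mul_inv_cancel₀ (by positivity)
    have a2 : 1 ≤ (1 + ‖x‖ ^ 2) * u := by
      calc (1:ℝ) = (1 + ‖x‖ ^ 2) * (1 + ‖x‖ ^ 2)⁻¹ := a1.symm
        _ ≤ _ := mul_le_mul_of_nonneg_left (le_max_left _ _) (by positivity)
    have a3 : t ^ 2 * ‖x‖ ^ 2 ≤ (1 + ‖x‖ ^ 2) * u := by
      rw [mul_comm]
      exact mul_le_mul (by linarith) (le_max_right _ _) (by positivity) (by positivity)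
    have a4 : 1 + ‖z‖ ^ 2 ≤ 6 * ((1 + ‖x‖ ^ 2) * u) := by linarith
    rw [show 6 * (1 + ‖z‖ ^ 2)⁻¹ * u = (6 * u) / (1 + ‖z‖ ^ 2) by ring, le_div_iff₀ (by positivity), inv_mul_le_iff₀ (by positivity)]
    linarith
  have hu0 : 0 ≤ u := le_max_of_le_right (by positivity)
  have h4 := Real.rpow_le_rpow (by positivity) h3 hb
  rw [Real.mul_rpow (by positivity) hu0, Real.mul_rpow (by positivity) (by positivity),
    Real.inv_rpow (by positivity), Real.inv_rpow (by positivity), ← Real.rpow_neg (by positivity), ← Real.rpow_neg (by positivity)] at h4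
  have h5 : u ^ (β / 2) ≤ wt β x + t ^ β := by
    have tt : (t ^ 2) ^ (β / 2) = t ^ β := by
      rw [← Real.rpow_natCast, ← Real.rpow_mul ht.le]; congr 1; push_cast; ring
    rcases max_cases ((1 + ‖x‖ ^ 2)⁻¹) (t ^ 2) with ⟨h, _⟩ | ⟨h, _⟩
    · rw [hu, h, Real.inv_rpow (by positivity), ← Real.rpow_neg (by positivity)]
      have : 0 ≤ t ^ β := by positivity
      unfold wt; linarith
    · rw [hu, h, tt]
      linarith [wt_pos β x]
  unfold wt at h5 ⊢
  refine h4.trans ?_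
  gcongr

lemma shift_ineq (β : ℝ) (hβ : 0 < β) (x y : E d) (hy : ‖y‖ ≤ 1) :
    wt β (x + y) ≤ 3 ^ (β / 2) * wt β x := by
  have h1 : ‖x‖ ≤ ‖x + y‖ + 1 := by
    have := norm_sub_le (x + y) y
    rw [add_sub_cancel_right] at this; linarith
  have h2 : 1 + ‖x‖ ^ 2 ≤ 3 * (1 + ‖x + y‖ ^ 2) := by
    nlinarith [norm_nonneg x, norm_nonneg (x + y), sq_nonneg (1 - ‖x + y‖)]
  have h3 : (1 + ‖x + y‖ ^ 2)⁻¹ ≤ 3 * (1 + ‖x‖ ^ 2)⁻¹ := by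
    rw [← div_eq_mul_inv, le_div_iff₀ (by positivity), inv_mul_le_iff₀ (by positivity)]
    linarith
  have h4 := Real.rpow_le_rpow (by positivity) h3 (show 0 ≤ β / 2 by positivity)
  rwa [Real.mul_rpow (by positivity) (by positivity),
    Real.inv_rpow (by positivity), Real.inv_rpow (by positivity), ← Real.rpow_neg (by positivity), ← Real.rpow_neg (by positivity)] at h4

def W (β : ℝ) (x : E d) : ENNReal := ENNReal.ofReal (wt β x)

lemma W_meas (β : ℝ) : Measurable (W (d := d) β) := (wt_cont β).measurable.ennreal_ofReal

lemma wt_int (β : ℝ) (hβ : (d : ℝ) < β) : Integrable (wt (d := d) β) := by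
  have := integrable_rpow_neg_one_add_norm_sq (E := E d) (μ := volume) (r := β) (by simpa using hβ)
  unfold wt
  convert this using 3
  ring

lemma W_fin (β : ℝ) (hβ : (d : ℝ) < β) : ∫⁻ x, W (d := d) β x ≠ ⊤ := by
  have := (wt_int β hβ).lintegral_lt_top
  exact this.ne

def bb : E d → ENNReal := (Metric.closedBall (0 : E d) 1).indicator 1

lemma bb_meas : Measurable (bb (d := d)) := measurable_one.indicator measurableSet_closedBall

lemma weight (β : ℝ) (hβ : (d : ℝ) < β) : ∃ A : ENNReal, A ≠ ⊤ ∧ ∀ z : E d, ∀ t : ℝ, 0 < t → t ≤ 1 →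
    ∫⁻ x, W β x * bb (z - t • x) ≤ A * W β z := by
  have hβ0 : 0 < β := lt_of_le_of_lt (by positivity) hβ
  refine ⟨ENNReal.ofReal (6 ^ (β / 2)) * ((∫⁻ x, W (d := d) β x) + volume (Metric.closedBall (0 : E d) 1)), ?_, ?_⟩
  · refine ENNReal.mul_ne_top (by simp) (ENNReal.add_ne_top.2 ⟨W_fin β hβ, measure_closedBall_lt_top.ne⟩)
  intro z t ht ht1
  have p : ∀ x, W β x * bb (z - t • x) ≤ ENNReal.ofReal (6 ^ (β / 2)) * W β z * (W β x + ENNReal.ofReal (t ^ β) * bb (z - t • x)) := by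
    intro x
    by_cases hx : z - t • x ∈ Metric.closedBall (0 : E d) 1
    · simp only [bb, Set.indicator_of_mem hx, Pi.one_apply, mul_one]
      unfold W
      rw [← ENNReal.ofReal_mul (by positivity), ← ENNReal.ofReal_add (wt_pos _ _).le (by positivity), ← ENNReal.ofReal_mul (mul_nonneg (by positivity) (wt_pos _ _).le)]
      exact ENNReal.ofReal_le_ofReal (real_ineq β hβ0 x z t ht (by simpa using hx))
    · simp [bb, Set.indicator_of_notMem hx]
  refine (lintegral_mono p).trans ?_
  have mb : Measurable (fun x : E d => bb (z - t • x)) := bb_meas.comp (by fun_prop)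
  rw [lintegral_const_mul _ (by have := W_meas (d := d) β; fun_prop), lintegral_add_left (W_meas β), lintegral_const_mul _ mb]
  have vol : ∫⁻ x : E d, bb (z - t • x) = ENNReal.ofReal ((t ^ d)⁻¹) * volume (Metric.closedBall (0 : E d) 1) := by
    have : (fun x : E d => bb (z - t • x)) = ((t • ·) ⁻¹' (Metric.closedBall z 1)).indicator 1 := by
      ext x
      have e : dist (z - t • x) 0 = dist (t • x) z := by
        rw [dist_zero_right, dist_eq_norm, norm_sub_rev]
      simp only [bb, Set.indicator, Metric.mem_closedBall, Set.mem_preimage, e, Pi.one_apply]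
    rw [this, lintegral_indicator_one ((measurable_const_smul t) measurableSet_closedBall), Measure.addHaar_preimage_smul _ ht.ne']
    rw [Measure.addHaar_closedBall_center]
    congr 2
    simp [abs_of_pos ht]
  rw [vol, ← mul_assoc (ENNReal.ofReal (t ^ β)), ← ENNReal.ofReal_mul (by positivity)]
  have : t ^ β * (t ^ d)⁻¹ ≤ 1 := by
    rw [← Real.rpow_natCast, ← Real.rpow_neg ht.le, ← Real.rpow_add ht]
    exact Real.rpow_le_one ht.le ht1 (by linarith)
  have : ENNReal.ofReal (t ^ β * (t ^ d)⁻¹) ≤ 1 := by simpa using ENNReal.ofReal_le_ofReal this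
  calc _ ≤ ENNReal.ofReal (6 ^ (β / 2)) * W β z * ((∫⁻ x, W (d := d) β x) + 1 * volume (Metric.closedBall (0 : E d) 1)) := by gcongr
    _ = _ := by rw [one_mul]; ring

lemma main_swap (β : ℝ) (hβ : (d : ℝ) < β) : ∃ A : ENNReal, A ≠ ⊤ ∧ ∀ h : E d → ℝ, Differentiable ℝ h →
    ∀ R : ℝ, 0 ≤ R →
    ∫⁻ y, ∫⁻ x, (Metric.closedBall (0 : E d) R).indicator 1 x * bb y * ‖h (x + y) - h y‖ₑ ^ 2 * W β x
      ≤ A * ENNReal.ofReal (R ^ 2) * ∫⁻ z, ‖fderiv ℝ h z‖ₑ ^ 2 * W β z := by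
  obtain ⟨A, hA, hw⟩ := weight (d := d) β hβ
  refine ⟨A, hA, fun h hh R hR => ?_⟩
  have mW := W_meas (d := d) β
  have mb := bb_meas (d := d)
  have mG : Measurable (fun z => ‖fderiv ℝ h z‖ₑ ^ 2) := (measurable_fderiv ℝ h).enorm.pow_const 2
  set G : E d → ENNReal := fun z => ‖fderiv ℝ h z‖ₑ ^ 2 with hG
  have s1 : ∀ y x : E d, (Metric.closedBall (0 : E d) R).indicator 1 x * bb y * ‖h (x + y) - h y‖ₑ ^ 2 * W β x
      ≤ ENNReal.ofReal (R ^ 2) * ∫⁻ t in Set.Ioc (0:ℝ) 1, bb y * G (y + t • x) * W β x := by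
    intro y x
    by_cases hx : x ∈ Metric.closedBall (0 : E d) R
    · rw [Set.indicator_of_mem hx, lintegral_mul_const _ (by fun_prop), lintegral_const_mul _ (by fun_prop)]
      have hxR : ‖x‖ₑ ^ 2 ≤ ENNReal.ofReal (R ^ 2) := by
        rw [ENNReal.ofReal_pow hR, ← ofReal_norm]
        gcongr
        simpa using hx
      calc _ ≤ 1 * bb y * (‖x‖ₑ ^ 2 * ∫⁻ t in Set.Ioc (0:ℝ) 1, G (y + t • x)) * W β x := by
            gcongr
            · rfl
            · exact line h hh x y
        _ ≤ 1 * bb y * (ENNReal.ofReal (R ^ 2) * ∫⁻ t in Set.Ioc (0:ℝ) 1, G (y + t • x)) * W β x := by gcongr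
        _ = _ := by ring
    · simp [Set.indicator_of_notMem hx]
  calc _ ≤ ∫⁻ y, ∫⁻ x, ENNReal.ofReal (R ^ 2) * ∫⁻ t in Set.Ioc (0:ℝ) 1, bb y * G (y + t • x) * W β x :=
        lintegral_mono fun y => lintegral_mono fun x => s1 y x
    _ = ENNReal.ofReal (R ^ 2) * ∫⁻ y, ∫⁻ x, ∫⁻ t in Set.Ioc (0:ℝ) 1, bb y * G (y + t • x) * W β x := by
        rw [← lintegral_const_mul' _ _ (by simp)]
        refine lintegral_congr fun y => ?_
        rw [← lintegral_const_mul' _ _ (by simp)]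
    _ = ENNReal.ofReal (R ^ 2) * ∫⁻ t in Set.Ioc (0:ℝ) 1, ∫⁻ x, ∫⁻ y, bb y * G (y + t • x) * W β x := by
        congr 1
        rw [lintegral_lintegral_swap (Measurable.aemeasurable (by
          refine Measurable.lintegral_prod_right' (f := fun p : (E d × E d) × ℝ => bb p.1.1 * G (p.1.1 + p.2 • p.1.2) * W β p.1.2) (by fun_prop)))]
        rw [lintegral_lintegral_swap (f := fun (t : ℝ) (x : E d) => ∫⁻ y, bb y * G (y + t • x) * W β x) (Measurable.aemeasurable (by
          refine Measurable.lintegral_prod_right' (f := fun p : (ℝ × E d) × E d => bb p.2 * G (p.2 + p.1.1 • p.1.2) * W β p.1.2) (by fun_prop)))]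
        refine lintegral_congr fun x => ?_
        rw [lintegral_lintegral_swap (Measurable.aemeasurable (by
          change Measurable (fun p : E d × ℝ => bb p.1 * G (p.1 + p.2 • x) * W β x)
          fun_prop))]
    _ ≤ ENNReal.ofReal (R ^ 2) * ∫⁻ t in Set.Ioc (0:ℝ) 1, A * ∫⁻ z, G z * W β z := by
        gcongr ENNReal.ofReal (R ^ 2) * ?_
        refine setLIntegral_mono' measurableSet_Ioc fun t ht => ?_
        calc _ = ∫⁻ x, ∫⁻ z, bb (z - t • x) * G z * W β x := by
              refine lintegral_congr fun x => ?_
              rw [← lintegral_add_right_eq_self (fun z => bb (z - t • x) * G z * W β x) (t • x)]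
              simp only [add_sub_cancel_right]
          _ = ∫⁻ z, ∫⁻ x, bb (z - t • x) * G z * W β x := by
              refine lintegral_lintegral_swap (Measurable.aemeasurable ?_)
              change Measurable (fun p : E d × E d => bb (p.2 - t • p.1) * G p.2 * W β p.1)
              fun_prop
          _ = ∫⁻ z, G z * ∫⁻ x, W β x * bb (z - t • x) := by
              refine lintegral_congr fun z => ?_
              rw [← lintegral_const_mul _ (by fun_prop)]
              refine lintegral_congr fun x => ?_
              ring
          _ ≤ ∫⁻ z, G z * (A * W β z) := by
              refine lintegral_mono fun z => ?_
              gcongr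
              exact hw z t ht.1 ht.2
          _ = _ := by
              rw [← lintegral_const_mul' _ _ hA]
              refine lintegral_congr fun z => ?_
              ring
    _ = _ := by
        simp; ring

lemma main_shift (β : ℝ) (hβ : (d : ℝ) < β) : ∃ A : ENNReal, A ≠ ⊤ ∧ ∀ h : E d → ℝ, Differentiable ℝ h →
    ∀ R : ℝ, 1 ≤ R →
    ∫⁻ y, bb y * ∫⁻ x, (Metric.closedBall (0 : E d) R).indicator 1 x * ‖h x - h y‖ₑ ^ 2 * W β x
      ≤ A * ENNReal.ofReal (R ^ 2) * ∫⁻ z, ‖fderiv ℝ h z‖ₑ ^ 2 * W β z := by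
  have hβ0 : 0 < β := lt_of_le_of_lt (by positivity) hβ
  obtain ⟨A, hA, hw⟩ := main_swap (d := d) β hβ
  refine ⟨ENNReal.ofReal (3 ^ (β / 2)) * A * 4, ENNReal.mul_ne_top (ENNReal.mul_ne_top (by simp) hA) (by simp), fun h hh R hR => ?_⟩
  have := hw h hh (R + 1) (by linarith)
  have e : ∀ y : E d, bb y * ∫⁻ x, (Metric.closedBall (0 : E d) R).indicator 1 x * ‖h x - h y‖ₑ ^ 2 * W β x
     ≤ ENNReal.ofReal (3 ^ (β / 2)) * ∫⁻ x, (Metric.closedBall (0 : E d) (R + 1)).indicator 1 x * bb y * ‖h (x + y) - h y‖ₑ ^ 2 * W β x := by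
    intro y
    by_cases hy : y ∈ Metric.closedBall (0 : E d) 1
    · simp only [bb, Set.indicator_of_mem hy, Pi.one_apply, one_mul, mul_one]
      rw [← lintegral_const_mul' _ _ (by simp)]
      rw [← lintegral_add_right_eq_self _ y]
      refine lintegral_mono fun x => ?_
      have hy1 : ‖y‖ ≤ 1 := by simpa using hy
      by_cases hx : x + y ∈ Metric.closedBall (0 : E d) R
      · have hx2 : x ∈ Metric.closedBall (0 : E d) (R + 1) := by
          have h1 : ‖x + y‖ ≤ R := by simpa using hx
          have := norm_sub_le (x + y) y
          rw [add_sub_cancel_right] at this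
          simp; linarith
        simp only [Set.indicator_of_mem hx, Set.indicator_of_mem hx2, Pi.one_apply, one_mul]
        have : W β (x + y) ≤ ENNReal.ofReal (3 ^ (β / 2)) * W β x := by
          unfold W
          rw [← ENNReal.ofReal_mul (by positivity)]
          exact ENNReal.ofReal_le_ofReal (shift_ineq β hβ0 x y hy1)
        calc _ ≤ ‖h (x + y) - h y‖ₑ ^ 2 * (ENNReal.ofReal (3 ^ (β / 2)) * W β x) := by gcongr
          _ = _ := by ring
      · simp [Set.indicator_of_notMem hx]
    · simp [bb, Set.indicator_of_notMem hy]
  refine (lintegral_mono e).trans ?_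
  rw [lintegral_const_mul' _ _ (by simp)]
  have r4 : ENNReal.ofReal ((R + 1) ^ 2) ≤ 4 * ENNReal.ofReal (R ^ 2) := by
    rw [show (4 : ENNReal) = ENNReal.ofReal 4 by simp, ← ENNReal.ofReal_mul (by norm_num)]
    refine ENNReal.ofReal_le_ofReal (by nlinarith)
  calc _ ≤ ENNReal.ofReal (3 ^ (β / 2)) * (A * (4 * ENNReal.ofReal (R ^ 2)) * ∫⁻ z, ‖fderiv ℝ h z‖ₑ ^ 2 * W β z) := by
        gcongr
        refine this.trans ?_
        gcongr
    _ = _ := by ring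

lemma tail (β : ℝ) (hβ : (d : ℝ) < β) : ∃ T : ENNReal, T ≠ ⊤ ∧ ∀ R : ℝ, 1 ≤ R →
    ∫⁻ x, ((Metric.closedBall (0 : E d) R)ᶜ).indicator 1 x * W β x ≤ T * ENNReal.ofReal (R ^ (-(β - d))) := by
  have hβ0 : 0 < β := lt_of_le_of_lt (by positivity) hβ
  refine ⟨ENNReal.ofReal (2 ^ (β / 2)) * ∫⁻ x, W (d := d) β x, ENNReal.mul_ne_top (by simp) (W_fin β hβ), fun R hR => ?_⟩
  have hR0 : 0 < R := by linarith
  have mW := W_meas (d := d) β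
  have p : ∀ x : E d, ((Metric.closedBall (0 : E d) R)ᶜ).indicator 1 x * W β x ≤
      ENNReal.ofReal (2 ^ (β / 2)) * ENNReal.ofReal (R ^ (-β)) * W β (R⁻¹ • x) := by
    intro x
    by_cases hx : x ∈ (Metric.closedBall (0 : E d) R)ᶜ
    · rw [Set.indicator_of_mem hx, Pi.one_apply, one_mul]
      have hx1 : R < ‖x‖ := by simpa using hx
      unfold W
      rw [← ENNReal.ofReal_mul (by positivity), ← ENNReal.ofReal_mul (by positivity)]
      refine ENNReal.ofReal_le_ofReal ?_
      unfold wt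
      have h3 : (1 + ‖x‖ ^ 2)⁻¹ ≤ 2 * (R ^ 2)⁻¹ * (1 + ‖R⁻¹ • x‖ ^ 2)⁻¹ := by
        rw [norm_smul, norm_inv, Real.norm_of_nonneg hR0.le, mul_assoc, ← mul_inv, ← div_eq_mul_inv,
          le_div_iff₀ (by positivity), inv_mul_le_iff₀ (by positivity)]
        have : R ^ 2 * (1 + (R⁻¹ * ‖x‖) ^ 2) = R ^ 2 + ‖x‖ ^ 2 := by field_simp
        rw [this]
        nlinarith
      have h4 := Real.rpow_le_rpow (by positivity) h3 (show 0 ≤ β / 2 by positivity)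
      rw [Real.mul_rpow (by positivity) (by positivity), Real.mul_rpow (by positivity) (by positivity),
        Real.inv_rpow (by positivity), Real.inv_rpow (by positivity), Real.inv_rpow (by positivity), ← Real.rpow_neg (by positivity), ← Real.rpow_neg (by positivity), ← Real.rpow_neg (by positivity)] at h4
      have tt : (R ^ 2) ^ (-(β / 2)) = R ^ (-β) := by
        rw [← Real.rpow_natCast, ← Real.rpow_mul hR0.le]; congr 1; push_cast; ring
      rwa [tt] at h4
    · simp [Set.indicator_of_notMem hx]
  refine (lintegral_mono p).trans ?_
  rw [lintegral_const_mul _ (by fun_prop)]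
  have sc : ∫⁻ x : E d, W β (R⁻¹ • x) = ENNReal.ofReal (R ^ d) * ∫⁻ x, W (d := d) β x := by
    rw [← lintegral_map mW (measurable_const_smul R⁻¹), Measure.map_addHaar_smul _ (by positivity), lintegral_smul_measure]
    simp [abs_of_pos hR0]
  rw [sc]
  have : R ^ (-(β - d)) = R ^ (-β) * R ^ d := by
    rw [← Real.rpow_natCast, ← Real.rpow_add hR0]; congr 1; ring
  rw [this, ENNReal.ofReal_mul (by positivity)]
  apply le_of_eq; ring

lemma bb_int : ∫⁻ y : E d, bb y = volume (Metric.closedBall (0 : E d) 1) := by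
  unfold bb
  rw [lintegral_indicator_one measurableSet_closedBall]

lemma core (β : ℝ) (hβ : (d : ℝ) < β) (c : ℝ) (hc : 0 < c) : ∃ A B : ℝ, 0 ≤ A ∧ 0 ≤ B ∧
    ∀ (h : E d → ℝ) (K I D : ℝ), Differentiable ℝ h → (∀ v, |h v| ≤ K) → 0 ≤ I → 0 ≤ D →
    (∀ y, ENNReal.ofReal I ≤ ENNReal.ofReal c * ∫⁻ x, ‖h x - h y‖ₑ ^ 2 * W β x) →
    (ENNReal.ofReal D = ENNReal.ofReal c * ∫⁻ x, ‖fderiv ℝ h x‖ₑ ^ 2 * W β x) →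
    ∀ R : ℝ, 1 ≤ R → I ≤ A * (R ^ 2 * D) + B * (K ^ 2 * R ^ (-(β - d))) := by
  obtain ⟨A, hA, hw⟩ := main_shift (d := d) β hβ
  obtain ⟨T, hT, ht⟩ := tail (d := d) β hβ
  set V := volume (Metric.closedBall (0 : E d) 1) with hV
  have hV0 : V ≠ 0 := (Metric.measure_closedBall_pos _ _ one_pos).ne'
  have hVt : V ≠ ⊤ := measure_closedBall_lt_top.ne
  have mW := W_meas (d := d) β
  have mb := bb_meas (d := d)
  refine ⟨(V⁻¹ * A).toReal, (ENNReal.ofReal c * 4 * T).toReal, by positivity, by positivity, ?_⟩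
  intro h K I D hh hK hI hD hy hDe R hR
  have hR0 : 0 < R := by linarith
  have mh : Measurable h := hh.continuous.measurable
  have split : ∀ y, ∫⁻ x, ‖h x - h y‖ₑ ^ 2 * W β x ≤
      (∫⁻ x, (Metric.closedBall (0 : E d) R).indicator 1 x * ‖h x - h y‖ₑ ^ 2 * W β x)
        + ENNReal.ofReal (4 * K ^ 2) * (T * ENNReal.ofReal (R ^ (-(β - d)))) := by
    intro y
    refine le_trans ?_ (add_le_add_right (mul_le_mul_right (ht R hR) _) _)
    have mi : Measurable ((Metric.closedBall (0 : E d) R).indicator (1 : E d → ENNReal)) :=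
      measurable_one.indicator measurableSet_closedBall
    rw [← lintegral_const_mul' _ _ ENNReal.ofReal_ne_top, ← lintegral_add_left (by fun_prop)]
    refine lintegral_mono fun x => ?_
    by_cases hx : x ∈ Metric.closedBall (0 : E d) R
    · simp [Set.indicator_of_mem hx]
    · have hx' : x ∈ (Metric.closedBall (0 : E d) R)ᶜ := hx
      rw [Set.indicator_of_notMem hx, Set.indicator_of_mem hx']
      simp only [zero_mul, zero_add, Pi.one_apply, one_mul]
      gcongr
      rw [← ofReal_norm, ← ENNReal.ofReal_pow (norm_nonneg _)]
      refine ENNReal.ofReal_le_ofReal ?_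
      rw [Real.norm_eq_abs, sq_abs]
      have h1 := abs_le.1 (hK x)
      have h2 := abs_le.1 (hK y)
      nlinarith
  have tot : V * ENNReal.ofReal I ≤ A * (ENNReal.ofReal (R ^ 2) * ENNReal.ofReal D)
      + V * (ENNReal.ofReal c * (ENNReal.ofReal (4 * K ^ 2) * (T * ENNReal.ofReal (R ^ (-(β - d)))))) := by
    set q := ENNReal.ofReal (4 * K ^ 2) * (T * ENNReal.ofReal (R ^ (-(β - d)))) with hq
    calc V * ENNReal.ofReal I = ∫⁻ y : E d, bb y * ENNReal.ofReal I := by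
          rw [lintegral_mul_const _ mb, bb_int]
      _ ≤ ∫⁻ y : E d, (ENNReal.ofReal c * (bb y * (∫⁻ x, (Metric.closedBall (0 : E d) R).indicator 1 x * ‖h x - h y‖ₑ ^ 2 * W β x))
            + bb y * (ENNReal.ofReal c * q)) := by
          refine lintegral_mono fun y => ?_
          calc _ ≤ bb y * (ENNReal.ofReal c * ((∫⁻ x, (Metric.closedBall (0 : E d) R).indicator 1 x * ‖h x - h y‖ₑ ^ 2 * W β x) + q)) := by
                gcongr
                refine (hy y).trans ?_
                gcongr
                exact split y
            _ = _ := by ring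
      _ = ENNReal.ofReal c * (∫⁻ y : E d, bb y * (∫⁻ x, (Metric.closedBall (0 : E d) R).indicator 1 x * ‖h x - h y‖ₑ ^ 2 * W β x))
            + V * (ENNReal.ofReal c * q) := by
          rw [lintegral_add_right _ (by fun_prop), lintegral_mul_const _ mb, bb_int, lintegral_const_mul' _ _ (by simp)]
      _ ≤ ENNReal.ofReal c * (A * ENNReal.ofReal (R ^ 2) * ∫⁻ z, ‖fderiv ℝ h z‖ₑ ^ 2 * W β z)
            + V * (ENNReal.ofReal c * q) := by
          gcongr
          exact hw h hh R hR
      _ = _ := by rw [hDe]; ring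
  have tot2 : ENNReal.ofReal I ≤ V⁻¹ * A * ENNReal.ofReal (R ^ 2 * D)
      + ENNReal.ofReal c * 4 * T * ENNReal.ofReal (K ^ 2 * R ^ (-(β - d))) := by
    have := mul_le_mul_right tot V⁻¹
    rw [← mul_assoc, ENNReal.inv_mul_cancel hV0 hVt, one_mul, mul_add, ← mul_assoc V⁻¹ V, ENNReal.inv_mul_cancel hV0 hVt] at this
    refine this.trans (le_of_eq ?_)
    rw [ENNReal.ofReal_mul (by positivity), ENNReal.ofReal_mul (by positivity), ENNReal.ofReal_mul (by positivity)]
    simp only [ENNReal.ofReal_ofNat]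
    ring
  have n1 : V⁻¹ * A ≠ ⊤ := ENNReal.mul_ne_top (by simpa using hV0) hA
  have n2 : ENNReal.ofReal c * 4 * T ≠ ⊤ := ENNReal.mul_ne_top (ENNReal.mul_ne_top (by simp) (by simp)) hT
  have fin := ENNReal.toReal_mono (ENNReal.add_ne_top.2 ⟨ENNReal.mul_ne_top n1 (by simp), ENNReal.mul_ne_top n2 (by simp)⟩) tot2
  rw [ENNReal.toReal_ofReal hI, ENNReal.toReal_add (ENNReal.mul_ne_top n1 (by simp)) (ENNReal.mul_ne_top n2 (by simp)),
    ENNReal.toReal_mul (a := V⁻¹ * A), ENNReal.toReal_mul (a := ENNReal.ofReal c * 4 * T), ENNReal.toReal_ofReal (by positivity), ENNReal.toReal_ofReal (by positivity)] at fin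
  exact fin

lemma optim (α A B I D K : ℝ) (hα : 0 < α) (hA : 0 ≤ A) (hB : 0 ≤ B) (hD : 0 ≤ D) (hIK : I ≤ K ^ 2)
    (hR : ∀ R : ℝ, 1 ≤ R → I ≤ A * (R ^ 2 * D) + B * (K ^ 2 * R ^ (-α))) :
    I ≤ (A + B + 1) * D ^ (α / (α + 2)) * (K ^ 2) ^ (2 / (α + 2)) := by
  have pos : ∀ D', 0 < D' → D ≤ D' → I ≤ (A + B + 1) * D' ^ (α / (α + 2)) * (K ^ 2) ^ (2 / (α + 2)) := by
    intro D' hD' hle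
    set M := K ^ 2 with hM
    have hM0 : 0 ≤ M := sq_nonneg K
    set P := D' ^ (α / (α + 2)) * M ^ (2 / (α + 2)) with hP
    have hP0 : 0 ≤ P := by positivity
    rw [mul_assoc, ← hP]
    rcases le_total M D' with hc | hc
    · have : M ≤ P := by
        calc M = M ^ (α / (α + 2)) * M ^ (2 / (α + 2)) := by
              rw [← Real.rpow_add_of_nonneg hM0 (by positivity) (by positivity), ← add_div, div_self (by positivity), Real.rpow_one]
          _ ≤ P := by rw [hP]; gcongr
      nlinarith [mul_nonneg hA hP0, mul_nonneg hB hP0]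
    · have hMp : 0 < M := hD'.trans_le hc
      have h1 := hR ((M / D') ^ (1 / (α + 2))) (Real.one_le_rpow ((one_le_div hD').2 hc) (by positivity))
      have e1 : ((M / D') ^ (1 / (α + 2))) ^ 2 * D' = P := by
        rw [← Real.rpow_natCast, ← Real.rpow_mul (by positivity), Real.div_rpow hM0 hD'.le, hP,
          show α / (α + 2) = 1 - 1 / (α + 2) * (2 : ℕ) by push_cast; field_simp; ring, Real.rpow_sub hD', Real.rpow_one,
          show 2 / (α + 2) = 1 / (α + 2) * (2 : ℕ) by push_cast; field_simp]
        ring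
      have e2 : M * ((M / D') ^ (1 / (α + 2))) ^ (-α) = P := by
        rw [← Real.rpow_mul (by positivity), Real.div_rpow hM0 hD'.le, hP,
          show 1 / (α + 2) * -α = -(α / (α + 2)) by ring, Real.rpow_neg hD'.le, Real.rpow_neg hM0,
          show 2 / (α + 2) = 1 - α / (α + 2) by field_simp; ring, Real.rpow_sub hMp, Real.rpow_one]
        field_simp
      have e3 : ((M / D') ^ (1 / (α + 2))) ^ 2 * D ≤ P := by
        rw [← e1]; gcongr
      rw [e2] at h1
      nlinarith [mul_le_mul_of_nonneg_left e3 hA]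
  have cont : Filter.Tendsto (fun D' : ℝ => (A + B + 1) * D' ^ (α / (α + 2)) * (K ^ 2) ^ (2 / (α + 2))) (nhdsWithin D (Set.Ioi D))
      (nhds ((A + B + 1) * D ^ (α / (α + 2)) * (K ^ 2) ^ (2 / (α + 2)))) := by
    have : Continuous (fun D' : ℝ => (A + B + 1) * D' ^ (α / (α + 2)) * (K ^ 2) ^ (2 / (α + 2))) := by
      have := Real.continuous_rpow_const (q := α / (α + 2)) (by positivity)
      fun_prop
    exact this.continuousAt.tendsto.mono_left nhdsWithin_le_nhds
  refine ge_of_tendsto cont ?_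
  filter_upwards [self_mem_nhdsWithin] with D' hD'
  exact pos D' (hD.trans_lt hD') (le_of_lt hD')

theorem stmt16 (d : ℕ) (hd : 1 ≤ d) (β : ℝ) (hβ : (d : ℝ) < β)
    (Cβ : ℝ) (hCβ : 0 < Cβ)
    (F : EuclideanSpace ℝ (Fin d) → ℝ)
    (hF : ∀ v, F v = Cβ ^ 2 * (1 + ‖v‖ ^ 2) ^ (-(β / 2)))
    (hnorm : ∫ v, F v = 1) :
    ∃ C : ℝ, 0 < C ∧
      ∀ (h : EuclideanSpace ℝ (Fin d) → ℝ) (K : ℝ), Differentiable ℝ h →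
        (∀ v, |h v| ≤ K) →
        Integrable (fun v => h v * F v) →
        Integrable (fun v => h v ^ 2 * F v) →
        Integrable (fun v => ‖gradient h v‖ ^ 2 * F v) →
        (∫ v, h v * F v) = 0 →
        ∫ v, h v ^ 2 * F v
          ≤ C * (∫ v, ‖gradient h v‖ ^ 2 * F v) ^ ((β - d) / (β - d + 2))
              * (K ^ 2) ^ (2 / (β - d + 2)) := by
  obtain ⟨A, B, hA, hB, hcore⟩ := core (d := d) β hβ (Cβ ^ 2) (by positivity)
  refine ⟨A + B + 1, by positivity, ?_⟩
  intro h K hh hK i1 i2 i3 h0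
  have hFw : ∀ v, F v = Cβ ^ 2 * wt β v := hF
  have F0 : ∀ v, 0 ≤ F v := fun v => by rw [hF]; positivity
  have iF : Integrable F := by
    have : F = fun v => Cβ ^ 2 * wt β v := funext hFw
    rw [this]; exact (wt_int β hβ).const_mul _
  have conv : ∀ (g : E d → ℝ), (∀ x, 0 ≤ g x) → Integrable (fun x => g x * F x) →
      ENNReal.ofReal (∫ x, g x * F x) = ENNReal.ofReal (Cβ ^ 2) * ∫⁻ x, ENNReal.ofReal (g x) * W β x := by
    intro g hg hi
    rw [ofReal_integral_eq_lintegral_ofReal hi (Filter.Eventually.of_forall fun x => mul_nonneg (hg x) (F0 x)),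
      ← lintegral_const_mul' _ _ (by simp)]
    refine lintegral_congr fun x => ?_
    rw [hFw, ENNReal.ofReal_mul (hg x), ENNReal.ofReal_mul (by positivity)]
    unfold W
    ring
  refine optim (β - d) A B _ _ K (by linarith) hA hB (integral_nonneg fun x => mul_nonneg (by positivity) (F0 x)) ?_ ?_
  · calc ∫ v, h v ^ 2 * F v ≤ ∫ v, K ^ 2 * F v := by
          refine integral_mono i2 (iF.const_mul _) fun v => ?_
          exact mul_le_mul_of_nonneg_right (sq_le_sq' (abs_le.1 (hK v)).1 (abs_le.1 (hK v)).2) (F0 v)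
      _ = K ^ 2 := by rw [integral_const_mul, hnorm, mul_one]
  · refine hcore h K _ _ hh hK (integral_nonneg fun x => mul_nonneg (by positivity) (F0 x))
      (integral_nonneg fun x => mul_nonneg (by positivity) (F0 x)) ?_ ?_
    · intro y
      have e : (fun x => (h x - h y) ^ 2 * F x) = fun x => (h x ^ 2 * F x - 2 * h y * (h x * F x)) + h y ^ 2 * F x := by
        ext x; ring
      have j1 : Integrable (fun x => h x ^ 2 * F x - 2 * h y * (h x * F x)) := i2.sub (i1.const_mul _)
      have ie : Integrable (fun x => (h x - h y) ^ 2 * F x) := by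
        rw [e]; exact j1.add (iF.const_mul _)
      have ge : ∫ x, h x ^ 2 * F x ≤ ∫ x, (h x - h y) ^ 2 * F x := by
        rw [e, integral_add j1 (iF.const_mul _), integral_sub i2 (i1.const_mul _), integral_const_mul, integral_const_mul, h0, hnorm]
        nlinarith [sq_nonneg (h y)]
      refine (ENNReal.ofReal_le_ofReal ge).trans ?_
      rw [conv _ (fun x => sq_nonneg _) ie]
      refine le_of_eq ?_
      congr 1
      refine lintegral_congr fun x => ?_
      rw [← ofReal_norm, ← ENNReal.ofReal_pow (norm_nonneg _), Real.norm_eq_abs, sq_abs]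
    · rw [conv _ (fun x => by positivity) i3]
      congr 1
      refine lintegral_congr fun x => ?_
      rw [← ofReal_norm, ← ENNReal.ofReal_pow (norm_nonneg _)]
      congr 3
      simp [gradient]

end
end
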